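/- Let σ_n be a uniform random 231-avoiding permutation of size n and let Ψ be a first-order sentence in the language with two binary relation symbols <_P and <_V. Write p_n = |{σ ∈ Av_n(231) : σ ⊨ Ψ}| / Cat_n. Then either lim_{n→∞} p_n > 0, or there exists ε = ε(Ψ) < 1 such that p_n = O(ε^n). -/

import Mathlib

open FirstOrder Filter Asymptotics Topology

namespace Av231

/-- Relation symbols of the theory of two orders: two binary relations `<_P` and `<_V`. -/
inductive TwoRel : ℕ → Type
  | lp : TwoRel 2
  | lv : TwoRel 2

/-- The first-order language with two binary relation symbols `<_P` and `<_V`. -/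
def L : Language := ⟨fun _ => Empty, TwoRel⟩

/-- The `L`-structure on `Fin n` associated with a permutation `σ` of `{1,…,n}`:
`i <_P j` iff `i < j` and `i <_V j` iff `σ i < σ j`. -/
def pStruct {n : ℕ} (σ : Equiv.Perm (Fin n)) : L.Structure (Fin n) where
  funMap := fun f _ => nomatch f
  RelMap := fun r x =>
    match r with
    | .lp => x 0 < x 1
    | .lv => σ (x 0) < σ (x 1)

/-- A permutation satisfies a first-order sentence. -/
def Sat {n : ℕ} (σ : Equiv.Perm (Fin n)) (ψ : L.Sentence) : Prop :=
  @Language.Sentence.Realize L (Fin n) (pStruct σ) ψ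

/-- The quantifier depth of a first-order formula. -/
def qd {L' : Language} {α : Type*} : ∀ {n : ℕ}, L'.BoundedFormula α n → ℕ
  | _, .falsum => 0
  | _, .equal _ _ => 0
  | _, .rel _ _ => 0
  | _, .imp f g => max (qd f) (qd g)
  | _, .all f => qd f + 1

/-- A permutation avoids the pattern `231`. -/
def Avoids {n : ℕ} (σ : Equiv.Perm (Fin n)) : Prop :=
  ¬ ∃ i j k : Fin n, i < j ∧ j < k ∧ σ k < σ i ∧ σ i < σ j

/-- The number of `231`-avoiding permutations of size `n` satisfying `ψ`. -/
noncomputable def avN (n : ℕ) (ψ : L.Sentence) : ℕ :=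
  Nat.card {σ : Equiv.Perm (Fin n) // Avoids σ ∧ Sat σ ψ}

/-- The probability that a uniform random `231`-avoiding permutation of size `n`
satisfies `ψ` (the number of `231`-avoiding permutations of size `n` is `catalan n`). -/
noncomputable def prob (n : ℕ) (ψ : L.Sentence) : ℝ :=
  (avN n ψ : ℝ) / (catalan n : ℝ)

/-- Permutations of arbitrary finite size. -/
abbrev FinPerm := Σ n : ℕ, Equiv.Perm (Fin n)

def AvoidsF (p : FinPerm) : Prop := Avoids p.2

/-- Direct sum of permutations. -/
def dsum {a b : ℕ} (σ : Equiv.Perm (Fin a)) (τ : Equiv.Perm (Fin b)) :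
    Equiv.Perm (Fin (a + b)) :=
  finSumFinEquiv.permCongr (Equiv.sumCongr σ τ)

/-- Skew sum of permutations. -/
def ssum {a b : ℕ} (σ : Equiv.Perm (Fin a)) (τ : Equiv.Perm (Fin b)) :
    Equiv.Perm (Fin (a + b)) :=
  finSumFinEquiv.symm.trans ((Equiv.sumCongr σ τ).trans
    ((Equiv.sumComm (Fin a) (Fin b)).trans (finSumFinEquiv.trans (finCongr (Nat.add_comm b a)))))

/-- The operation `(τ, π) ↦ τ ⊕ (1 ⊖ π)` on permutations of arbitrary sizes. -/
def glue (τ π : FinPerm) : FinPerm :=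
  ⟨τ.1 + (1 + π.1), dsum τ.2 (ssum (1 : Equiv.Perm (Fin 1)) π.2)⟩

/-- Two permutations are `k`-equivalent when they satisfy the same first-order sentences
of quantifier depth at most `k`. -/
def kEquiv (k : ℕ) (p q : FinPerm) : Prop :=
  ∀ ψ : L.Sentence, qd ψ ≤ k → (Sat p.2 ψ ↔ Sat q.2 ψ)


/-! ### Back-and-forth equivalence -/

/-- A set with two binary relations and two unary predicates. The predicates record the position
of a distinguished hole: `hP x` says that `x` is before the hole, `hV x` that it is below. -/
structure Marked where
  carrier : Type
  P : carrier → carrier → Prop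
  V : carrier → carrier → Prop
  hP : carrier → Prop
  hV : carrier → Prop

instance : CoeSort Marked Type := ⟨Marked.carrier⟩

namespace Marked

/-- The pairs in `R` form a partial isomorphism. -/
def Atomic (A B : Marked) (R : Set (A × B)) : Prop :=
  ∀ p ∈ R, ∀ q ∈ R, (p.1 = q.1 ↔ p.2 = q.2) ∧ (A.P p.1 q.1 ↔ B.P p.2 q.2) ∧
    (A.V p.1 q.1 ↔ B.V p.2 q.2) ∧ (A.hP p.1 ↔ B.hP p.2) ∧ (A.hV p.1 ↔ B.hV p.2)

/-- Duplicator wins the `k`-round Ehrenfeucht–Fraïssé game from the position `R`. -/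
def EF (A B : Marked) : ℕ → Set (A × B) → Prop
  | 0, R => Atomic A B R
  | k + 1, R => Atomic A B R ∧ (∀ a, ∃ b, EF A B k (insert (a, b) R)) ∧
      ∀ b, ∃ a, EF A B k (insert (a, b) R)

variable {A B C D A' B' : Marked}

theorem EF.atomic {k : ℕ} {R : Set (A × B)} (h : EF A B k R) : Atomic A B R := by
  cases k with
  | zero => exact h
  | succ k => exact h.1

theorem EF.mono {k : ℕ} {R S : Set (A × B)} (h : EF A B k S) (hRS : R ⊆ S) : EF A B k R := by
  induction k generalizing R S with
  | zero => exact fun p hp q hq => h p (hRS hp) q (hRS hq)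
  | succ k ih =>
    refine ⟨fun p hp q hq => h.1 p (hRS hp) q (hRS hq), fun a => ?_, fun b => ?_⟩
    · obtain ⟨b, hb⟩ := h.2.1 a
      exact ⟨b, ih hb (Set.insert_subset_insert hRS)⟩
    · obtain ⟨a, ha⟩ := h.2.2 b
      exact ⟨a, ih ha (Set.insert_subset_insert hRS)⟩

theorem EF.symm {k : ℕ} {R : Set (A × B)} (h : EF A B k R) : EF B A k (Prod.swap ⁻¹' R) := by
  have key (a : A) (b : B) (R : Set (A × B)) :
      insert (b, a) (Prod.swap ⁻¹' R) = Prod.swap ⁻¹' (insert (a, b) R) := by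
    ext ⟨x, y⟩
    simp [and_comm]
  induction k generalizing R with
  | zero =>
    intro p hp q hq
    have := h _ hp _ hq
    simp only [Prod.fst_swap, Prod.snd_swap] at this
    tauto
  | succ k ih =>
    refine ⟨fun p hp q hq => ?_, fun b => ?_, fun a => ?_⟩
    · have := h.1 _ hp _ hq
      simp only [Prod.fst_swap, Prod.snd_swap] at this
      tauto
    · obtain ⟨a, ha⟩ := h.2.2 b
      exact ⟨a, key a b R ▸ ih ha⟩
    · obtain ⟨b, hb⟩ := h.2.1 a
      exact ⟨b, key a b R ▸ ih hb⟩

/-- An isomorphism of marked structures. -/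
structure Iso (A B : Marked) extends A.carrier ≃ B.carrier where
  map_P : ∀ x y, A.P x y ↔ B.P (toFun x) (toFun y)
  map_V : ∀ x y, A.V x y ↔ B.V (toFun x) (toFun y)
  map_hP : ∀ x, A.hP x ↔ B.hP (toFun x)
  map_hV : ∀ x, A.hV x ↔ B.hV (toFun x)

/-- The identity isomorphism. -/
def Iso.refl (A : Marked) : Iso A A := ⟨Equiv.refl _, by simp, by simp, by simp, by simp⟩

/-- The inverse isomorphism. -/
def Iso.symm (e : Iso A B) : Iso B A :=
  ⟨e.toEquiv.symm,
    fun x y => by simpa using (e.map_P (e.toEquiv.symm x) (e.toEquiv.symm y)).symm,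
    fun x y => by simpa using (e.map_V (e.toEquiv.symm x) (e.toEquiv.symm y)).symm,
    fun x => by simpa using (e.map_hP (e.toEquiv.symm x)).symm,
    fun x => by simpa using (e.map_hV (e.toEquiv.symm x)).symm⟩

/-- The composition of isomorphisms. -/
def Iso.trans (e : Iso A B) (f : Iso B C) : Iso A C :=
  ⟨e.toEquiv.trans f.toEquiv,
    fun x y => (e.map_P x y).trans (f.map_P _ _),
    fun x y => (e.map_V x y).trans (f.map_V _ _),
    fun x => (e.map_hP x).trans (f.map_hP _),
    fun x => (e.map_hV x).trans (f.map_hV _)⟩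

theorem EF.map {k : ℕ} {R : Set (A × B)} (h : EF A B k R) (e : Iso A A') (f : Iso B B') :
    EF A' B' k (Prod.map e.toEquiv f.toEquiv '' R) := by
  have key (R : Set (A × B)) (h : Atomic A B R) :
      Atomic A' B' (Prod.map e.toEquiv f.toEquiv '' R) := by
    rintro _ ⟨p, hp, rfl⟩ _ ⟨q, hq, rfl⟩
    obtain ⟨h1, h2, h3, h4, h5⟩ := h p hp q hq
    refine ⟨by simpa using h1, (e.map_P _ _).symm.trans (h2.trans (f.map_P _ _)),
      (e.map_V _ _).symm.trans (h3.trans (f.map_V _ _)),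
      (e.map_hP _).symm.trans (h4.trans (f.map_hP _)),
      (e.map_hV _).symm.trans (h5.trans (f.map_hV _))⟩
  induction k generalizing R with
  | zero => exact key R h
  | succ k ih =>
    refine ⟨key R h.1, fun a => ?_, fun b => ?_⟩
    · obtain ⟨b, hb⟩ := h.2.1 (e.toEquiv.symm a)
      refine ⟨f.toEquiv b, ?_⟩
      simpa [Set.image_insert_eq] using ih hb
    · obtain ⟨a, ha⟩ := h.2.2 (f.toEquiv.symm b)
      refine ⟨e.toEquiv a, ?_⟩
      simpa [Set.image_insert_eq] using ih ha

theorem EF.diag (A : Marked) (k : ℕ) {R : Set (A × A)} (hR : ∀ p ∈ R, p.1 = p.2) :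
    EF A A k R := by
  have key (R : Set (A × A)) (hR : ∀ p ∈ R, p.1 = p.2) : Atomic A A R := by
    intro p hp q hq
    simp [hR p hp, hR q hq]
  induction k generalizing R with
  | zero => exact key R hR
  | succ k ih =>
    exact ⟨key R hR, fun a => ⟨a, ih (by simpa using hR)⟩, fun a => ⟨a, ih (by simpa using hR)⟩⟩

theorem EF.of_iso (k : ℕ) (e : Iso A B) : EF A B k ∅ := by
  simpa using (EF.diag A k (R := ∅) (by simp)).map (Iso.refl A) e

/-- Replace the predicates by constants. -/
def remark (A : Marked) (a b : Prop) : Marked := ⟨A, A.P, A.V, fun _ => a, fun _ => b⟩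

theorem EF.remark {k : ℕ} {R : Set (A × B)} (h : EF A B k R) (a b : Prop) :
    EF (A.remark a b) (B.remark a b) k R := by
  have key (R : Set (A × B)) (h : Atomic A B R) : Atomic (A.remark a b) (B.remark a b) R :=
    fun p hp q hq => ⟨(h p hp q hq).1, (h p hp q hq).2.1, (h p hp q hq).2.2.1, Iff.rfl, Iff.rfl⟩
  induction k generalizing R with
  | zero => exact key R h
  | succ k ih =>
    refine ⟨key R h.1, fun x => ?_, fun y => ?_⟩
    · obtain ⟨y, hy⟩ := h.2.1 x
      exact ⟨y, ih hy⟩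
    · obtain ⟨x, hx⟩ := h.2.2 y
      exact ⟨x, ih hx⟩

/-- Fill the hole of `A` with `B`; the hole of `B` becomes the hole of the result. -/
def comp (A B : Marked) : Marked where
  carrier := A ⊕ B
  P := fun x y => match x, y with
    | .inl x, .inl y => A.P x y
    | .inl x, .inr _ => A.hP x
    | .inr _, .inl y => ¬ A.hP y
    | .inr x, .inr y => B.P x y
  V := fun x y => match x, y with
    | .inl x, .inl y => A.V x y
    | .inl x, .inr _ => A.hV x
    | .inr _, .inl y => ¬ A.hV y
    | .inr x, .inr y => B.V x y
  hP := Sum.elim A.hP B.hP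
  hV := Sum.elim A.hV B.hV

/-- The disjoint union of two positions of the game. -/
def sumRel (R : Set (A × B)) (S : Set (C × D)) : Set (A.comp C × B.comp D) :=
  {p | (∃ q ∈ R, p = (.inl q.1, .inl q.2)) ∨ ∃ q ∈ S, p = (.inr q.1, .inr q.2)}

theorem insert_inl_sumRel (R : Set (A × B)) (S : Set (C × D)) (a : A) (b : B) :
    insert ((Sum.inl a : A.comp C), (Sum.inl b : B.comp D)) (sumRel R S) =
      sumRel (insert (a, b) R) S := by
  ext p
  constructor
  · rintro (rfl | ⟨q, hq, rfl⟩ | ⟨q, hq, rfl⟩)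
    exacts [.inl ⟨_, .inl rfl, rfl⟩, .inl ⟨q, .inr hq, rfl⟩, .inr ⟨q, hq, rfl⟩]
  · rintro (⟨q, rfl | hq, rfl⟩ | ⟨q, hq, rfl⟩)
    exacts [.inl rfl, .inr (.inl ⟨q, hq, rfl⟩), .inr (.inr ⟨q, hq, rfl⟩)]

theorem insert_inr_sumRel (R : Set (A × B)) (S : Set (C × D)) (a : C) (b : D) :
    insert ((Sum.inr a : A.comp C), (Sum.inr b : B.comp D)) (sumRel R S) =
      sumRel R (insert (a, b) S) := by
  ext p
  constructor
  · rintro (rfl | ⟨q, hq, rfl⟩ | ⟨q, hq, rfl⟩)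
    exacts [.inr ⟨_, .inl rfl, rfl⟩, .inl ⟨q, hq, rfl⟩, .inr ⟨q, .inr hq, rfl⟩]
  · rintro (⟨q, hq, rfl⟩ | ⟨q, rfl | hq, rfl⟩)
    exacts [.inr (.inl ⟨q, hq, rfl⟩), .inl rfl, .inr (.inr ⟨q, hq, rfl⟩)]

theorem Atomic.comp {R : Set (A × B)} {S : Set (C × D)} (h : Atomic A B R) (h' : Atomic C D S) :
    Atomic (A.comp C) (B.comp D) (sumRel R S) := by
  rintro _ (⟨p, hp, rfl⟩ | ⟨p, hp, rfl⟩) _ (⟨q, hq, rfl⟩ | ⟨q, hq, rfl⟩)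
  · obtain ⟨h₁, h₂, h₃, h₄, h₅⟩ := h p hp q hq
    exact ⟨Sum.inl_injective.eq_iff.trans (h₁.trans Sum.inl_injective.eq_iff.symm), h₂, h₃, h₄, h₅⟩
  · obtain ⟨-, -, -, h₄, h₅⟩ := h p hp p hp
    exact ⟨iff_of_false Sum.inl_ne_inr Sum.inl_ne_inr, h₄, h₅, h₄, h₅⟩
  · obtain ⟨-, -, -, h₄, h₅⟩ := h q hq q hq
    obtain ⟨-, -, -, h₄', h₅'⟩ := h' p hp p hp
    exact ⟨iff_of_false Sum.inr_ne_inl Sum.inr_ne_inl, not_congr h₄, not_congr h₅, h₄', h₅'⟩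
  · obtain ⟨h₁, h₂, h₃, h₄, h₅⟩ := h' p hp q hq
    exact ⟨Sum.inr_injective.eq_iff.trans (h₁.trans Sum.inr_injective.eq_iff.symm), h₂, h₃, h₄, h₅⟩

theorem EF.comp {k : ℕ} {R : Set (A × B)} {S : Set (C × D)} (h : EF A B k R)
    (h' : EF C D k S) : EF (A.comp C) (B.comp D) k (sumRel R S) := by
  induction k generalizing R S with
  | zero => exact Atomic.comp h h'
  | succ k ih =>
    have drop {A B : Marked} {k : ℕ} {R : Set (A × B)} (h : EF A B (k + 1) R) : EF A B k R := by
      induction k generalizing R with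
      | zero => exact h.1
      | succ k ih =>
        refine ⟨h.1, fun a => ?_, fun b => ?_⟩
        · obtain ⟨b, hb⟩ := h.2.1 a
          exact ⟨b, ih hb⟩
        · obtain ⟨a, ha⟩ := h.2.2 b
          exact ⟨a, ih ha⟩
    refine ⟨Atomic.comp h.1 h'.1, ?_, ?_⟩
    · rintro (a | a)
      · obtain ⟨b, hb⟩ := h.2.1 a
        exact ⟨.inl b, insert_inl_sumRel R S a b ▸ ih hb (drop h')⟩
      · obtain ⟨b, hb⟩ := h'.2.1 a
        exact ⟨.inr b, insert_inr_sumRel R S a b ▸ ih (drop h) hb⟩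
    · rintro (b | b)
      · obtain ⟨a, ha⟩ := h.2.2 b
        exact ⟨.inl a, insert_inl_sumRel R S a b ▸ ih ha (drop h')⟩
      · obtain ⟨a, ha⟩ := h'.2.2 b
        exact ⟨.inr a, insert_inr_sumRel R S a b ▸ ih (drop h) ha⟩

theorem sumRel_empty : sumRel (∅ : Set (A × B)) (∅ : Set (C × D)) = ∅ := by
  simp [sumRel]

theorem EF.comp_empty {k : ℕ} (h : EF A B k ∅) (h' : EF C D k ∅) :
    EF (A.comp C) (B.comp D) k ∅ := by
  simpa only [sumRel_empty] using h.comp h'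

/-- Isomorphisms can be composed in parallel. -/
def Iso.comp (e : Iso A B) (f : Iso C D) : Iso (A.comp C) (B.comp D) where
  toEquiv := Equiv.sumCongr e.toEquiv f.toEquiv
  map_P := by
    rintro (x | x) (y | y)
    exacts [e.map_P x y, e.map_hP x, not_congr (e.map_hP y), f.map_P x y]
  map_V := by
    rintro (x | x) (y | y)
    exacts [e.map_V x y, e.map_hV x, not_congr (e.map_hV y), f.map_V x y]
  map_hP := by
    rintro (x | x)
    exacts [e.map_hP x, f.map_hP x]
  map_hV := by
    rintro (x | x)
    exacts [e.map_hV x, f.map_hV x]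

/-- Composition is associative. -/
def Iso.assoc (A B C : Marked) : Iso ((A.comp B).comp C) (A.comp (B.comp C)) where
  toEquiv := Equiv.sumAssoc A B C
  map_P := by rintro ((x | x) | x) ((y | y) | y) <;> exact Iff.rfl
  map_V := by rintro ((x | x) | x) ((y | y) | y) <;> exact Iff.rfl
  map_hP := by rintro ((x | x) | x) <;> exact Iff.rfl
  map_hV := by rintro ((x | x) | x) <;> exact Iff.rfl

/-- An isomorphism remains one after remarking. -/
def Iso.remark (e : Iso A B) (a b : Prop) : Iso (A.remark a b) (B.remark a b) :=
  ⟨e.toEquiv, e.map_P, e.map_V, fun _ => Iff.rfl, fun _ => Iff.rfl⟩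

/-- The structure with no elements. -/
def empty : Marked := ⟨Empty, fun _ _ => False, fun _ _ => False, fun _ => False, fun _ => False⟩

/-- The structure with one element. -/
def point (a b : Prop) : Marked :=
  ⟨Unit, fun _ _ => False, fun _ _ => False, fun _ => a, fun _ => b⟩

/-- The empty structure is a left unit. -/
def Iso.emptyComp (A : Marked) : Iso (empty.comp A) A where
  toEquiv := Equiv.emptySum Empty A
  map_P := by rintro (x | x) (y | y) <;> first | cases x | cases y | exact Iff.rfl
  map_V := by rintro (x | x) (y | y) <;> first | cases x | cases y | exact Iff.rfl
  map_hP := by rintro (x | x) <;> first | cases x | exact Iff.rfl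
  map_hV := by rintro (x | x) <;> first | cases x | exact Iff.rfl

/-- The `n`-fold composition of `A` with itself. -/
def pow (A : Marked) : ℕ → Marked
  | 0 => empty
  | n + 1 => A.comp (A.pow n)

/-- The composition of `i + 1 + j` copies splits around the copy of index `i`. -/
def Iso.powSplit (A : Marked) : (i j : ℕ) →
    Iso (A.pow (i + 1 + j)) ((A.pow i).comp (A.comp (A.pow j)))
  | 0, j => by
    rw [show 0 + 1 + j = j + 1 by omega]
    exact (Iso.emptyComp _).symm
  | i + 1, j => by
    rw [show i + 1 + 1 + j = (i + 1 + j) + 1 by omega]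
    exact ((Iso.refl A).comp (Iso.powSplit A i j)).trans (Iso.assoc _ _ _).symm

theorem exists_powSplit (A : Marked) (n : ℕ) (x : A.pow n) :
    ∃ i j, i + 1 + j = n ∧ ∃ (e : Iso (A.pow n) ((A.pow i).comp (A.comp (A.pow j)))) (y : A),
      e.toEquiv x = .inr (.inl y) := by
  induction n with
  | zero => exact x.elim
  | succ n ih =>
    rcases x with x | x
    · exact ⟨0, n, by omega, (Iso.emptyComp _).symm, x, rfl⟩
    · obtain ⟨i, j, h, e, y, hy⟩ := ih x
      refine ⟨i + 1, j, by omega, ((Iso.refl A).comp e).trans (Iso.assoc _ _ _).symm, y, ?_⟩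
      change (Equiv.sumAssoc _ _ _).symm (Sum.inr (e.toEquiv x)) = _
      rw [hy]
      rfl

theorem EF.pow_of_le (A : Marked) (k m n : ℕ) (hm : 2 ^ k ≤ m + 1) (hn : 2 ^ k ≤ n + 1) :
    EF (A.pow m) (A.pow n) k ∅ := by
  induction k generalizing m n with
  | zero => exact fun p hp => hp.elim
  | succ k ih =>
    have forth (m n : ℕ) (hm : 2 ^ (k + 1) ≤ m + 1) (hn : 2 ^ (k + 1) ≤ n + 1) (x : A.pow m) :
        ∃ y : A.pow n, EF (A.pow m) (A.pow n) k {(x, y)} := by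
      obtain ⟨i, j, hij, e, a, ha⟩ := exists_powSplit A m x
      rw [pow_succ] at hm hn
      have hpos : 0 < 2 ^ k := by positivity
      obtain ⟨i', j', hn', hi, hj⟩ : ∃ i' j', n = i' + 1 + j' ∧
          (i = i' ∨ (2 ^ k ≤ i + 1 ∧ 2 ^ k ≤ i' + 1)) ∧
          (j = j' ∨ (2 ^ k ≤ j + 1 ∧ 2 ^ k ≤ j' + 1)) := by
        rcases Nat.lt_or_ge (i + 1) (2 ^ k) with h | h
        · exact ⟨i, n - 1 - i, by omega, by omega, by omega⟩
        · rcases Nat.lt_or_ge (j + 1) (2 ^ k) with h' | h'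
          · exact ⟨n - 1 - j, j, by omega, by omega, by omega⟩
          · exact ⟨2 ^ k - 1, n - 2 ^ k, by omega, by omega, by omega⟩
      have aux {i i' : ℕ} (hi : i = i' ∨ (2 ^ k ≤ i + 1 ∧ 2 ^ k ≤ i' + 1)) :
          EF (A.pow i) (A.pow i') k ∅ := by
        rcases hi with rfl | hi
        · exact EF.of_iso k (Iso.refl _)
        · exact ih _ _ hi.1 hi.2
      subst hn'
      have f := Iso.powSplit A i' j'
      have := ((aux hi).comp ((EF.diag A k (R := {(a, a)}) (by simp)).comp (aux hj))).map
        e.symm f.symm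
      refine ⟨f.toEquiv.symm (.inr (.inl a)), this.mono ?_⟩
      rintro _ rfl
      refine ⟨(.inr (.inl a), .inr (.inl a)), .inr ⟨(.inl a, .inl a), ?_, rfl⟩, ?_⟩
      · exact .inl ⟨(a, a), rfl, rfl⟩
      · exact Prod.ext (e.toEquiv.symm_apply_eq.2 ha.symm) rfl
    refine ⟨fun p hp => hp.elim, fun x => ?_, fun y => ?_⟩
    · simpa using forth m n hm hn x
    · obtain ⟨x, hx⟩ := forth n m hn hm y
      exact ⟨x, hx.symm.mono (by rintro _ (rfl | h); exacts [rfl, h.elim])⟩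

/-! ### Back-and-forth equivalence and first-order logic -/

/-- The position of the game given by two tuples. -/
def pairs {n : ℕ} (a : Fin n → A) (b : Fin n → B) : Set (A × B) := Set.range fun i => (a i, b i)

theorem pairs_snoc {n : ℕ} (a : Fin n → A) (b : Fin n → B) (x : A) (y : B) :
    pairs (Fin.snoc a x : Fin (n + 1) → A) (Fin.snoc b y) = insert (x, y) (pairs a b) := by
  ext p
  simp only [pairs, Set.mem_range, Set.mem_insert_iff, Fin.exists_fin_succ', Fin.snoc_castSucc,
    Fin.snoc_last]
  rw [or_comm, eq_comm (a := p)]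

/-- The relation of `k`-round equivalence has finite index. -/
theorem exists_finite_invariant (k n : ℕ) :
    ∃ (F : Type) (_ : Finite F) (f : (A : Marked) → (Fin n → A) → F),
      ∀ (A B : Marked) (a : Fin n → A) (b : Fin n → B), f A a = f B b → EF A B k (pairs a b) := by
  have base (n : ℕ) : ∃ (F : Type) (_ : Finite F) (f : (A : Marked) → (Fin n → A) → F),
      ∀ (A B : Marked) (a : Fin n → A) (b : Fin n → B), f A a = f B b →
        Atomic A B (pairs a b) := by
    refine ⟨Fin n → Fin n → Prop × Prop × Prop × Prop × Prop, inferInstance,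
      fun A a i j => (a i = a j, A.P (a i) (a j), A.V (a i) (a j), A.hP (a i), A.hV (a i)), ?_⟩
    rintro A B a b h _ ⟨i, rfl⟩ _ ⟨j, rfl⟩
    simpa only [Prod.mk.injEq, eq_iff_iff] using congrFun (congrFun h i) j
  induction k generalizing n with
  | zero => exact base n
  | succ k ih =>
    obtain ⟨F₀, _, f₀, h₀⟩ := base n
    obtain ⟨F, _, f, hf⟩ := ih (n + 1)
    refine ⟨F₀ × Set F, inferInstance,
      fun A a => (f₀ A a, Set.range fun x : A => f A (Fin.snoc a x)), fun A B a b h => ?_⟩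
    obtain ⟨h₁, h₂⟩ := Prod.mk.inj h
    refine ⟨h₀ A B a b h₁, fun x => ?_, fun y => ?_⟩
    · obtain ⟨y, hy⟩ : f A (Fin.snoc a x) ∈ Set.range fun y : B => f B (Fin.snoc b y) :=
        h₂ ▸ ⟨x, rfl⟩
      exact ⟨y, pairs_snoc a b x y ▸ hf _ _ _ _ hy.symm⟩
    · obtain ⟨x, hx⟩ : f B (Fin.snoc b y) ∈ Set.range fun x : A => f A (Fin.snoc a x) :=
        h₂ ▸ ⟨y, rfl⟩
      exact ⟨x, pairs_snoc a b x y ▸ hf _ _ _ _ hx⟩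

/-- The first-order structure underlying a marked structure. -/
@[reducible] def toStructure (A : Marked) : L.Structure A where
  funMap := fun f _ => nomatch f
  RelMap := fun r x =>
    match r with
    | .lp => A.P (x 0) (x 1)
    | .lv => A.V (x 0) (x 1)

theorem exists_index_of_term {n : ℕ} (t : L.Term (Empty ⊕ Fin n)) :
    ∃ i : Fin n, t = .var (.inr i) := by
  rcases t with (i | i) | f
  exacts [i.elim, ⟨i, rfl⟩, nomatch f]

theorem realize_iff_of_EF {n k : ℕ} (φ : L.BoundedFormula Empty n) (hφ : qd φ ≤ k)
    (v : Empty → A) (w : Empty → B) (a : Fin n → A) (b : Fin n → B) (h : EF A B k (pairs a b)) :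
    @Language.BoundedFormula.Realize L A A.toStructure _ _ φ v a ↔
      @Language.BoundedFormula.Realize L B B.toStructure _ _ φ w b := by
  induction φ generalizing k with
  | falsum => exact Iff.rfl
  | equal t₁ t₂ =>
    obtain ⟨i, rfl⟩ := exists_index_of_term t₁
    obtain ⟨j, rfl⟩ := exists_index_of_term t₂
    exact (h.atomic _ ⟨i, rfl⟩ _ ⟨j, rfl⟩).1
  | rel R ts =>
    rcases R with _ | _
    · obtain ⟨i, hi⟩ := exists_index_of_term (ts 0)
      obtain ⟨j, hj⟩ := exists_index_of_term (ts 1)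
      change A.P (@Language.Term.realize L A A.toStructure _ (Sum.elim v a) (ts 0))
          (@Language.Term.realize L A A.toStructure _ (Sum.elim v a) (ts 1)) ↔
        B.P (@Language.Term.realize L B B.toStructure _ (Sum.elim w b) (ts 0))
          (@Language.Term.realize L B B.toStructure _ (Sum.elim w b) (ts 1))
      rw [hi, hj]
      exact (h.atomic _ ⟨i, rfl⟩ _ ⟨j, rfl⟩).2.1
    · obtain ⟨i, hi⟩ := exists_index_of_term (ts 0)
      obtain ⟨j, hj⟩ := exists_index_of_term (ts 1)
      change A.V (@Language.Term.realize L A A.toStructure _ (Sum.elim v a) (ts 0))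
          (@Language.Term.realize L A A.toStructure _ (Sum.elim v a) (ts 1)) ↔
        B.V (@Language.Term.realize L B B.toStructure _ (Sum.elim w b) (ts 0))
          (@Language.Term.realize L B B.toStructure _ (Sum.elim w b) (ts 1))
      rw [hi, hj]
      exact (h.atomic _ ⟨i, rfl⟩ _ ⟨j, rfl⟩).2.2.1
  | imp f g hf hg =>
    rw [qd, max_le_iff] at hφ
    exact imp_congr (hf hφ.1 a b h) (hg hφ.2 a b h)
  | all f hf =>
    rw [qd] at hφ
    obtain ⟨k, rfl⟩ : ∃ k', k = k' + 1 := ⟨k - 1, by omega⟩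
    constructor
    · intro H y
      obtain ⟨x, hx⟩ := h.2.2 y
      exact (hf (by omega) (Fin.snoc a x) (Fin.snoc b y) (pairs_snoc a b x y ▸ hx)).1 (H x)
    · intro H x
      obtain ⟨y, hy⟩ := h.2.1 x
      exact (hf (by omega) (Fin.snoc a x) (Fin.snoc b y) (pairs_snoc a b x y ▸ hy)).2 (H y)

/-- Satisfaction of a sentence in a marked structure. -/
def Models (A : Marked) (ψ : L.Sentence) : Prop := @Language.Sentence.Realize L A A.toStructure ψ

theorem EF.models_iff {ψ : L.Sentence} (h : EF A B (qd ψ) ∅) : A.Models ψ ↔ B.Models ψ := by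
  refine realize_iff_of_EF ψ le_rfl _ _ _ _ (h.mono ?_)
  rintro _ ⟨i, -⟩
  exact i.elim0

/-- The marked structure of a permutation. -/
def ofPerm {n : ℕ} (σ : Equiv.Perm (Fin n)) : Marked :=
  ⟨Fin n, fun i j => i < j, fun i j => σ i < σ j, fun _ => False, fun _ => False⟩

theorem sat_iff_models {n : ℕ} (σ : Equiv.Perm (Fin n)) (ψ : L.Sentence) :
    Sat σ ψ ↔ (ofPerm σ).Models ψ := by
  have : pStruct σ = (ofPerm σ).toStructure := by
    refine Language.Structure.ext (funext fun _ => funext fun f => nomatch f) ?_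
    funext _ r _
    cases r <;> rfl
  rw [Sat, this]
  rfl

/-! ### Binary trees as marked structures -/

/-- The structure `A ⊕ (1 ⊖ B)`, with trivial marks. -/
def graft (A B : Marked) : Marked :=
  ((A.remark True True).comp ((point True False).comp B)).remark False False

/-- The structure of a binary tree: the root is the largest value, the left subtree is before the
root and below the right subtree, which is after the root. -/
def ofTree : BinaryTree Unit → Marked
  | .nil => empty
  | .node _ l r => graft (ofTree l) (ofTree r)

/-- Fill the hole of `A` with `B`, leaving no hole. -/
def fill (A B : Marked) : Marked := (A.comp B).remark False False

/-- Filling successively two holes. -/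
def Iso.fillFill (A B C : Marked) : Iso (A.fill (B.fill C)) ((A.comp B).fill C) where
  toEquiv := (Equiv.sumAssoc A B C).symm
  map_P := by rintro (x | x | x) (y | y | y) <;> exact Iff.rfl
  map_V := by rintro (x | x | x) (y | y | y) <;> exact Iff.rfl
  map_hP := fun _ => Iff.rfl
  map_hV := fun _ => Iff.rfl

/-- Filling the hole with isomorphic structures. -/
def Iso.fill (A : Marked) (e : Iso B C) : Iso (A.fill B) (A.fill C) :=
  ((Iso.refl A).comp e).remark False False

/-- `A ⊕ (1 ⊖ ·)` as a context. -/
def Iso.graftLeft (A B : Marked) :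
    Iso (graft A B) (((A.remark True True).comp (point True False)).fill B) :=
  (Iso.assoc _ _ _).symm.remark False False

/-- `· ⊕ (1 ⊖ B)` as a context. -/
def Iso.graftRight (A B : Marked) :
    Iso (graft A B) ((((point True False).comp B).remark False False).fill A) where
  toEquiv := Equiv.sumComm _ _
  map_P := by
    rintro (x | x | x) (y | y | y) <;>
      first
        | exact Iff.rfl
        | exact iff_of_true trivial fun h => h
        | exact iff_of_false (fun h => h trivial) fun h => h
  map_V := by
    rintro (x | x | x) (y | y | y) <;>
      first
        | exact Iff.rfl
        | exact iff_of_true trivial fun h => h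
        | exact iff_of_false (fun h => h trivial) fun h => h
  map_hP := fun _ => Iff.rfl
  map_hV := fun _ => Iff.rfl

theorem ofTree_hP (t : BinaryTree Unit) (x : ofTree t) : (ofTree t).hP x ↔ False := by
  cases t with
  | nil => exact x.elim
  | node => exact Iff.rfl

theorem ofTree_hV (t : BinaryTree Unit) (x : ofTree t) : (ofTree t).hV x ↔ False := by
  cases t with
  | nil => exact x.elim
  | node => exact Iff.rfl

theorem nonempty_iso_empty_fill (t : BinaryTree Unit) :
    Nonempty (Iso (ofTree t) (empty.fill (ofTree t))) :=
  ⟨(Iso.emptyComp (ofTree t)).toEquiv.symm, (Iso.emptyComp (ofTree t)).symm.map_P,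
    (Iso.emptyComp (ofTree t)).symm.map_V, ofTree_hP t, ofTree_hV t⟩

theorem EF.graft {k : ℕ} (h : EF A B k ∅) (h' : EF C D k ∅) :
    EF (graft A C) (graft B D) k ∅ :=
  ((h.remark True True).comp_empty
    ((EF.of_iso k (Iso.refl _)).comp_empty h')).remark False False

end Marked

open Marked

/-! ### The finite algebra of types of trees -/

/-- Trees up to `k`-round equivalence. -/
def TreeType (k : ℕ) : Type := Quot fun s t => EF (ofTree s) (ofTree t) k ∅

/-- The type of a tree. -/
def treeType (k : ℕ) (t : BinaryTree Unit) : TreeType k := Quot.mk _ t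

theorem treeType_surjective (k : ℕ) : Function.Surjective (treeType k) := Quot.exists_rep

theorem treeType_eq {k : ℕ} {s t : BinaryTree Unit} (h : EF (ofTree s) (ofTree t) k ∅) :
    treeType k s = treeType k t := Quot.sound h

instance (k : ℕ) : Finite (TreeType k) := by
  obtain ⟨F, _, f, hf⟩ := exists_finite_invariant k 0
  let g : BinaryTree Unit → F := fun t => f (ofTree t) Fin.elim0
  refine Finite.of_surjective (fun x : Set.range g => treeType k x.2.choose) fun q => ?_
  obtain ⟨t, rfl⟩ := treeType_surjective k q
  refine ⟨⟨g t, t, rfl⟩, treeType_eq ((hf _ _ _ _ (Exists.choose_spec (p := fun s => g s = g t)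
    ⟨t, rfl⟩)).mono (Set.empty_subset _))⟩

/-- The operation on types induced by the formation of trees. -/
def TreeType.op {k : ℕ} : TreeType k → TreeType k → TreeType k :=
  Quot.map₂ (fun l r => .node () l r)
    (fun _ _ _ h => (EF.of_iso k (Iso.refl _)).graft h)
    (fun _ _ _ h => h.graft (EF.of_iso k (Iso.refl _)))

theorem treeType_node (k : ℕ) (l r : BinaryTree Unit) :
    treeType k (.node () l r) = (treeType k l).op (treeType k r) := rfl

/-- The maps of an algebra into itself generated by the translations. -/
inductive IsContext {Q : Type} (op : Q → Q → Q) : (Q → Q) → Prop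
  | id : IsContext op id
  | left (q : Q) (f : Q → Q) : IsContext op f → IsContext op fun x => f (op q x)
  | right (q : Q) (f : Q → Q) : IsContext op f → IsContext op fun x => f (op x q)

theorem TreeType.exists_fill {k : ℕ} {f : TreeType k → TreeType k}
    (hf : IsContext TreeType.op f) : ∃ C : Marked, ∀ t, ∃ t',
      f (treeType k t) = treeType k t' ∧ Nonempty (Iso (ofTree t') (C.fill (ofTree t))) := by
  induction hf with
  | id => exact ⟨empty, fun t => ⟨t, rfl, nonempty_iso_empty_fill t⟩⟩
  | left q f _ ih =>
    obtain ⟨C, hC⟩ := ih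
    obtain ⟨l, rfl⟩ := treeType_surjective k q
    refine ⟨C.comp (((ofTree l).remark True True).comp (point True False)), fun t => ?_⟩
    obtain ⟨t', ht', ⟨e⟩⟩ := hC (.node () l t)
    exact ⟨t', ht', ⟨(e.trans (Iso.fill C (Iso.graftLeft _ _))).trans (Iso.fillFill C _ _)⟩⟩
  | right q f _ ih =>
    obtain ⟨C, hC⟩ := ih
    obtain ⟨r, rfl⟩ := treeType_surjective k q
    refine ⟨C.comp (((point True False).comp (ofTree r)).remark False False), fun t => ?_⟩
    obtain ⟨t', ht', ⟨e⟩⟩ := hC (.node () t r)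
    exact ⟨t', ht', ⟨(e.trans (Iso.fill C (Iso.graftRight _ _))).trans (Iso.fillFill C _ _)⟩⟩

theorem TreeType.iterate_eq_iterate_succ {k : ℕ} {f : TreeType k → TreeType k}
    (hf : IsContext TreeType.op f) : f^[2 ^ k] = f^[2 ^ k + 1] := by
  obtain ⟨C, hC⟩ := TreeType.exists_fill hf
  have key (t : BinaryTree Unit) (n : ℕ) : ∃ t', f^[n] (treeType k t) = treeType k t' ∧
      Nonempty (Iso (ofTree t') ((C.pow n).fill (ofTree t))) := by
    induction n with
    | zero => exact ⟨t, rfl, nonempty_iso_empty_fill t⟩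
    | succ n ih =>
      obtain ⟨t₁, h₁, ⟨e₁⟩⟩ := ih
      obtain ⟨t₂, h₂, ⟨e₂⟩⟩ := hC t₁
      refine ⟨t₂, ?_, ⟨(e₂.trans (Iso.fill C e₁)).trans (Iso.fillFill C _ _)⟩⟩
      rw [Function.iterate_succ_apply', h₁, h₂]
  funext q
  obtain ⟨t, rfl⟩ := treeType_surjective k q
  obtain ⟨t₁, h₁, ⟨e₁⟩⟩ := key t (2 ^ k)
  obtain ⟨t₂, h₂, ⟨e₂⟩⟩ := key t (2 ^ k + 1)
  rw [h₁, h₂]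
  apply treeType_eq
  have := (((EF.pow_of_le C k (2 ^ k) (2 ^ k + 1) (by omega) (by omega)).comp_empty
    (EF.of_iso k (Iso.refl (ofTree t)))).remark False False).map e₁.symm e₂.symm
  exact this.mono (Set.empty_subset _)

/-! ### Synchronization -/

theorem IsContext.comp {Q : Type} {op : Q → Q → Q} {f g : Q → Q} (hf : IsContext op f)
    (hg : IsContext op g) : IsContext op (f ∘ g) := by
  induction hg with
  | id => exact hf
  | left q g _ ih => exact .left q _ ih
  | right q g _ ih => exact .right q _ ih

theorem IsContext.iterate {Q : Type} {op : Q → Q → Q} {f : Q → Q} (hf : IsContext op f) (n : ℕ) :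
    IsContext op f^[n] := by
  induction n with
  | zero => exact .id
  | succ n ih => exact ih.comp hf

/-- In a finite algebra whose contexts are aperiodic, some context is constant. -/
theorem exists_constant_context {Q : Type} [Finite Q] [Nonempty Q] (op : Q → Q → Q)
    (hap : ∀ f, IsContext op f → ∃ n, f^[n] = f^[n + 1]) :
    ∃ (f : Q → Q) (q : Q), IsContext op f ∧ ∀ x, f x = q := by
  obtain ⟨g, hg, hmin⟩ : ∃ g, IsContext op g ∧ ∀ f, IsContext op f →
      (Set.range g).ncard ≤ (Set.range f).ncard := by
    obtain ⟨g, hg, hmin⟩ := Set.exists_min_image {f : Q → Q | IsContext op f}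
      (fun f => (Set.range f).ncard) (Set.toFinite _) ⟨id, .id⟩
    exact ⟨g, hg, hmin⟩
  obtain ⟨n, hn⟩ := hap g hg
  have stab (m : ℕ) : g^[n + m] = g^[n] := by
    induction m with
    | zero => rfl
    | succ m ih =>
      rw [← add_assoc, Function.iterate_succ, ih, ← Function.iterate_succ, ← hn]
  -- `e` is an idempotent context of minimal rank
  let e := g^[n + 1]
  have he : IsContext op e := hg.iterate _
  have hee (x : Q) : e (e x) = e x := by
    have : g^[(n + 1) + (n + 1)] = g^[n + 1] := by
      rw [show n + 1 + (n + 1) = n + (n + 2) by ring, stab, stab]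
    rw [Function.iterate_add] at this
    exact congrFun this x
  have hrange : (Set.range e).ncard ≤ (Set.range g).ncard := by
    refine Set.ncard_le_ncard ?_
    rintro _ ⟨x, rfl⟩
    exact ⟨g^[n] x, (Function.iterate_succ_apply' g n x).symm⟩
  have fixed (c : Q → Q) (hc : IsContext op c) (x : Q) : e (c (e x)) = e x := by
    let h := e ∘ c ∘ e
    have hh : IsContext op h := he.comp (hc.comp he)
    have hsub : Set.range h ⊆ Set.range e := by
      rintro _ ⟨x, rfl⟩
      exact ⟨_, rfl⟩
    have heq : Set.range h = Set.range e :=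
      Set.eq_of_subset_of_ncard_le hsub (hrange.trans (hmin h hh))
    have hmaps : Set.MapsTo h (Set.range e) (Set.range e) := fun x _ => hsub ⟨x, rfl⟩
    have hsurj : Set.SurjOn h (Set.range e) (Set.range e) := by
      intro y hy
      obtain ⟨x, rfl⟩ := heq ▸ hy
      exact ⟨e x, ⟨x, rfl⟩, congrArg (e ∘ c) (hee x)⟩
    have hinj : Set.InjOn h (Set.range e) :=
      (Set.toFinite _).injOn_of_encard_image_eq (by rw [hsurj.image_eq_of_mapsTo hmaps])
    obtain ⟨m, hm⟩ := hap h hh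
    have hx : e x ∈ Set.range e := ⟨x, rfl⟩
    have := (hinj.iterate hmaps m) (hmaps hx) hx
      ((Function.iterate_succ_apply h m (e x)).symm.trans (congrFun hm (e x)).symm)
    simpa [h, hee] using this
  refine ⟨e, e (Classical.arbitrary Q), he, fun x => ?_⟩
  set y := Classical.arbitrary Q
  have h₁ := fixed (fun z => op z (e y)) (.right _ _ .id) x
  have h₂ := fixed (fun z => op (e x) z) (.left _ _ .id) y
  exact h₁.symm.trans h₂
/-! ### 231-avoiding structures are the structures of trees -/

namespace Marked

/-- A structure without marks whose relations are two strict total orders avoiding `231`. -/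
structure IsAv (A : Marked) : Prop where
  P_irrefl : ∀ x, ¬ A.P x x
  P_trans : ∀ x y z, A.P x y → A.P y z → A.P x z
  P_total : ∀ x y, x ≠ y → A.P x y ∨ A.P y x
  V_irrefl : ∀ x, ¬ A.V x x
  V_trans : ∀ x y z, A.V x y → A.V y z → A.V x z
  V_total : ∀ x y, x ≠ y → A.V x y ∨ A.V y x
  avoids : ∀ x y z, A.P x y → A.P y z → A.V z x → A.V x y → False
  not_hP : ∀ x, ¬ A.hP x
  not_hV : ∀ x, ¬ A.hV x

variable {A B : Marked}

theorem IsAv.graft (hA : IsAv A) (hB : IsAv B) : IsAv (graft A B) where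
  P_irrefl := by
    rintro (x | x | x)
    exacts [hA.P_irrefl x, fun h => h, hB.P_irrefl x]
  P_trans := by
    rintro (x | x | x) (y | y | y) (z | z | z) <;>
      simp [Marked.graft, comp, Marked.remark, point]
    exacts [hA.P_trans x y z, hB.P_trans x y z]
  P_total := by
    rintro (x | x | x) (y | y | y) h <;> simp [Marked.graft, comp, Marked.remark, point]
    exacts [hA.P_total x y fun e => h (e ▸ rfl), h rfl, hB.P_total x y fun e => h (e ▸ rfl)]
  V_irrefl := by
    rintro (x | x | x)
    exacts [hA.V_irrefl x, fun h => h, hB.V_irrefl x]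
  V_trans := by
    rintro (x | x | x) (y | y | y) (z | z | z) <;>
      simp [Marked.graft, comp, Marked.remark, point]
    exacts [hA.V_trans x y z, hB.V_trans x y z]
  V_total := by
    rintro (x | x | x) (y | y | y) h <;> simp [Marked.graft, comp, Marked.remark, point]
    exacts [hA.V_total x y fun e => h (e ▸ rfl), h rfl, hB.V_total x y fun e => h (e ▸ rfl)]
  avoids := by
    rintro (x | x | x) (y | y | y) (z | z | z) <;>
      simp [Marked.graft, comp, Marked.remark, point]
    exacts [hA.avoids x y z, hB.avoids x y z]
  not_hP := fun _ h => h
  not_hV := fun _ h => h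

theorem isAv_ofTree (t : BinaryTree Unit) : IsAv (ofTree t) := by
  induction t with
  | nil => constructor <;> rintro ⟨⟩
  | node _ l r hl hr => exact hl.graft hr

instance finite_ofTree (t : BinaryTree Unit) : Finite (ofTree t) := by
  induction t with
  | nil => exact inferInstanceAs (Finite Empty)
  | node _ l r hl hr => exact inferInstanceAs (Finite (ofTree l ⊕ (Unit ⊕ ofTree r)))

theorem card_ofTree (t : BinaryTree Unit) : Nat.card (ofTree t) = t.numNodes := by
  induction t with
  | nil => exact Nat.card_of_isEmpty (α := Empty)
  | node _ l r hl hr =>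
    change Nat.card (ofTree l ⊕ (Unit ⊕ ofTree r)) = _
    rw [Nat.card_sum, Nat.card_sum, hl, hr, Nat.card_unique, BinaryTree.numNodes]
    ring

/-- The induced substructure. -/
def sub (A : Marked) (s : Set A) : Marked :=
  ⟨s, fun x y => A.P x y, fun x y => A.V x y, fun x => A.hP x, fun x => A.hV x⟩

theorem IsAv.sub (hA : IsAv A) (s : Set A) : IsAv (A.sub s) where
  P_irrefl _ := hA.P_irrefl _
  P_trans _ _ _ := hA.P_trans _ _ _
  P_total _ _ h := hA.P_total _ _ fun e => h (Subtype.ext e)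
  V_irrefl _ := hA.V_irrefl _
  V_trans _ _ _ := hA.V_trans _ _ _
  V_total _ _ h := hA.V_total _ _ fun e => h (Subtype.ext e)
  avoids _ _ _ := hA.avoids _ _ _
  not_hP _ := hA.not_hP _
  not_hV _ := hA.not_hV _

theorem IsAv.exists_max [Finite A] [Nonempty A] (hA : IsAv A) : ∃ m, ∀ x, x ≠ m → A.V x m := by
  have : IsTrans A (fun x y => A.V y x) := ⟨fun _ _ _ h h' => hA.V_trans _ _ _ h' h⟩
  have : Std.Irrefl (fun x y : A => A.V y x) := ⟨hA.V_irrefl⟩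
  have wf : WellFounded (fun x y : A => A.V y x) := Finite.wellFounded_of_trans_of_irrefl _
  obtain ⟨m, -, hm⟩ := wf.has_min Set.univ Set.univ_nonempty
  exact ⟨m, fun x hx => (hA.V_total x m hx).resolve_right (hm x trivial)⟩

/-- A 231-avoiding structure decomposes around its largest value. -/
theorem IsAv.nonempty_iso_graft (hA : IsAv A) {m : A} (hm : ∀ x, x ≠ m → A.V x m) :
    Nonempty (Iso (Marked.graft (A.sub {x | A.P x m}) (A.sub {x | A.P m x})) A) := by
  let f : {x | A.P x m} ⊕ (Unit ⊕ {x | A.P m x}) → A :=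
    Sum.elim Subtype.val (Sum.elim (fun _ => m) Subtype.val)
  have lt_root (x : A) (h : A.P x m) : A.V x m := hm x fun e => hA.P_irrefl m (e ▸ h)
  have gt_root (x : A) (h : A.P m x) : A.V x m := hm x fun e => hA.P_irrefl m (e ▸ h)
  have P_asymm (x y : A) (h : A.P x y) : ¬ A.P y x :=
    fun h' => hA.P_irrefl _ (hA.P_trans _ _ _ h h')
  have V_asymm (x y : A) (h : A.V x y) : ¬ A.V y x :=
    fun h' => hA.V_irrefl _ (hA.V_trans _ _ _ h h')
  have cross_P (x y : A) (hx : A.P x m) (hy : A.P m y) : A.P x y := hA.P_trans _ _ _ hx hy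
  have cross_V (x y : A) (hx : A.P x m) (hy : A.P m y) : A.V x y := by
    refine (hA.V_total x y fun e => ?_).resolve_right fun h => ?_
    · exact P_asymm _ _ hx (e ▸ hy)
    · exact hA.avoids x m y hx hy h (lt_root x hx)
  have hf : Function.Bijective f := by
    constructor
    · have before (x : A) (hx : A.P x m) : x ≠ m := fun e => hA.P_irrefl m (e ▸ hx)
      have after (x : A) (hx : A.P m x) : x ≠ m := fun e => hA.P_irrefl m (e ▸ hx)
      have apart (x y : A) (hx : A.P x m) (hy : A.P m y) : x ≠ y :=
        fun e => P_asymm _ _ hx (e ▸ hy)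
      rintro (⟨x, hx⟩ | x | ⟨x, hx⟩) (⟨y, hy⟩ | y | ⟨y, hy⟩) h
      exacts [congrArg Sum.inl (Subtype.ext h), (before x hx h).elim, (apart x y hx hy h).elim,
        (before y hy h.symm).elim, rfl, (after y hy h.symm).elim, (apart y x hy hx h.symm).elim,
        (after x hx h).elim, congrArg (Sum.inr ∘ Sum.inr) (Subtype.ext h)]
    · intro x
      by_cases h : x = m
      · exact ⟨.inr (.inl ()), h.symm⟩
      · rcases hA.P_total x m h with h | h
        exacts [⟨.inl ⟨x, h⟩, rfl⟩, ⟨.inr (.inr ⟨x, h⟩), rfl⟩]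
  refine ⟨⟨Equiv.ofBijective f hf, ?_, ?_, fun x => iff_of_false id (hA.not_hP _),
    fun x => iff_of_false id (hA.not_hV _)⟩⟩
  · rintro (⟨x, hx⟩ | x | ⟨x, hx⟩) (⟨y, hy⟩ | y | ⟨y, hy⟩)
    exacts [Iff.rfl, iff_of_true trivial hx, iff_of_true trivial (cross_P x y hx hy),
      iff_of_false (fun h => h trivial) (P_asymm _ _ hy), iff_of_false id (hA.P_irrefl _),
      iff_of_true trivial hy, iff_of_false (fun h => h trivial) (P_asymm _ _ (cross_P y x hy hx)),
      iff_of_false (fun h => h trivial) (P_asymm _ _ hx), Iff.rfl]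
  · rintro (⟨x, hx⟩ | x | ⟨x, hx⟩) (⟨y, hy⟩ | y | ⟨y, hy⟩)
    exacts [Iff.rfl, iff_of_true trivial (lt_root x hx), iff_of_true trivial (cross_V x y hx hy),
      iff_of_false (fun h => h trivial) (V_asymm _ _ (lt_root y hy)),
      iff_of_false id (hA.V_irrefl _), iff_of_false id (V_asymm _ _ (gt_root y hy)),
      iff_of_false (fun h => h trivial) (V_asymm _ _ (cross_V y x hy hx)),
      iff_of_true id (gt_root x hx), Iff.rfl]

/-- Grafts of isomorphic structures are isomorphic. -/
def Iso.graft {C D : Marked} (e : Iso A B) (f : Iso C D) :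
    Iso (Marked.graft A C) (Marked.graft B D) :=
  ((e.remark True True).comp ((Iso.refl _).comp f)).remark False False

theorem IsAv.exists_ofTree [Finite A] (hA : IsAv A) : ∃ t, Nonempty (Iso (ofTree t) A) := by
  generalize hn : Nat.card A = n
  induction n using Nat.strong_induction_on generalizing A with
  | _ n ih =>
    rcases isEmpty_or_nonempty A with h | h
    · exact ⟨.nil, ⟨Equiv.equivOfIsEmpty Empty A, by rintro ⟨⟩, by rintro ⟨⟩, by rintro ⟨⟩,
        by rintro ⟨⟩⟩⟩
    · obtain ⟨m, hm⟩ := hA.exists_max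
      have aux (s : Set A) (hs : m ∉ s) : ∃ t, Nonempty (Iso (ofTree t) (A.sub s)) := by
        have : Finite (A.sub s) := inferInstanceAs (Finite s)
        refine ih _ ?_ (hA.sub s) rfl
        rw [← hn, ← Set.ncard_univ A]
        exact Set.ncard_lt_ncard (s := s) (Set.ssubset_univ_iff.2 fun e => hs (e ▸ trivial))
      obtain ⟨l, ⟨e⟩⟩ := aux {x | A.P x m} (hA.P_irrefl m)
      obtain ⟨r, ⟨f⟩⟩ := aux {x | A.P m x} (hA.P_irrefl m)
      obtain ⟨g⟩ := hA.nonempty_iso_graft hm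
      exact ⟨.node () l r, ⟨(e.graft f).trans g⟩⟩

theorem Iso.exists_graft_decomp {C D : Marked} (e : Iso (Marked.graft A B) (Marked.graft C D)) :
    (∀ x, ∃ y, e.toEquiv (.inl x) = .inl y) ∧
      ∀ x, ∃ y, e.toEquiv (.inr (.inr x)) = .inr (.inr y) := by
  have root : e.toEquiv (.inr (.inl ())) = .inr (.inl ()) := by
    rcases h : e.toEquiv.symm (.inr (.inl ())) with x | x | x
    · have := (e.map_V (.inl x) (.inr (.inl ()))).1 trivial
      have h' := e.toEquiv.symm_apply_eq.1 h
      change (Marked.graft C D).V (e.toEquiv _) (e.toEquiv _) at this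
      rw [← h'] at this
      rcases h'' : e.toEquiv (.inr (.inl ())) with y | y | y <;> rw [h''] at this
      exacts [(this trivial).elim, rfl, this.elim]
    · exact (e.toEquiv.symm_apply_eq.1 h).symm
    · have := (e.map_V (.inr (.inr x)) (.inr (.inl ()))).1 id
      have h' := e.toEquiv.symm_apply_eq.1 h
      change (Marked.graft C D).V (e.toEquiv _) (e.toEquiv _) at this
      rw [← h'] at this
      rcases h'' : e.toEquiv (.inr (.inl ())) with y | y | y <;> rw [h''] at this
      exacts [(this trivial).elim, rfl, this.elim]
  constructor
  · intro x
    have := (e.map_P (.inl x) (.inr (.inl ()))).1 trivial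
    change (Marked.graft C D).P (e.toEquiv _) (e.toEquiv _) at this
    rw [root] at this
    rcases h : e.toEquiv (.inl x) with y | y | y <;> rw [h] at this
    exacts [⟨y, rfl⟩, this.elim, (this trivial).elim]
  · intro x
    have := (e.map_P (.inr (.inl ())) (.inr (.inr x))).1 trivial
    change (Marked.graft C D).P (e.toEquiv _) (e.toEquiv _) at this
    rw [root] at this
    rcases h : e.toEquiv (.inr (.inr x)) with y | y | y <;> rw [h] at this
    exacts [(this trivial).elim, this.elim, ⟨y, rfl⟩]

theorem nonempty_iso_of_inter (hA : IsAv A) (hB : IsAv B) {C D : Marked} (e : Iso C D)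
    (i : A → C) (j : B → D) (hj : Function.Injective j) (hi : Function.Injective i)
    (hiP : ∀ x y, A.P x y ↔ C.P (i x) (i y)) (hiV : ∀ x y, A.V x y ↔ C.V (i x) (i y))
    (hjP : ∀ x y, B.P x y ↔ D.P (j x) (j y)) (hjV : ∀ x y, B.V x y ↔ D.V (j x) (j y))
    (h : ∀ x, ∃ y, e.toEquiv (i x) = j y) (h' : ∀ y, ∃ x, e.symm.toEquiv (j y) = i x) :
    Nonempty (Iso A B) := by
  choose f hf using h
  have hbij : Function.Bijective f := by
    constructor
    · intro x y hxy
      exact hi (e.toEquiv.injective (by rw [hf, hf, hxy]))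
    · intro y
      obtain ⟨x, hx⟩ := h' y
      refine ⟨x, hj ?_⟩
      rw [← hf, ← hx]
      exact e.toEquiv.apply_symm_apply _
  refine ⟨⟨Equiv.ofBijective f hbij, fun x y => ?_, fun x y => ?_,
    fun x => iff_of_false (hA.not_hP x) (hB.not_hP _),
    fun x => iff_of_false (hA.not_hV x) (hB.not_hV _)⟩⟩
  · rw [hiP, e.map_P]
    change D.P (e.toEquiv (i x)) (e.toEquiv (i y)) ↔ _
    rw [hf, hf, ← hjP]
    rfl
  · rw [hiV, e.map_V]
    change D.V (e.toEquiv (i x)) (e.toEquiv (i y)) ↔ _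
    rw [hf, hf, ← hjV]
    rfl

theorem eq_of_iso_ofTree {s t : BinaryTree Unit} (e : Iso (ofTree s) (ofTree t)) : s = t := by
  induction s generalizing t with
  | nil =>
    cases t with
    | nil => rfl
    | node => exact (e.toEquiv.symm (.inr (.inl ()))).elim
  | node a l r hl hr =>
    cases t with
    | nil => exact (e.toEquiv (.inr (.inl ()))).elim
    | node b l' r' =>
      obtain ⟨h₁, h₂⟩ := e.exists_graft_decomp
      obtain ⟨h₁', h₂'⟩ := e.symm.exists_graft_decomp
      obtain ⟨f⟩ := nonempty_iso_of_inter (isAv_ofTree l) (isAv_ofTree l') e .inl .inl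
        Sum.inl_injective Sum.inl_injective (fun _ _ => Iff.rfl) (fun _ _ => Iff.rfl)
        (fun _ _ => Iff.rfl) (fun _ _ => Iff.rfl) h₁ h₁'
      obtain ⟨g⟩ := nonempty_iso_of_inter (isAv_ofTree r) (isAv_ofTree r') e
        (fun x => .inr (.inr x)) (fun x => .inr (.inr x))
        (Sum.inr_injective.comp Sum.inr_injective) (Sum.inr_injective.comp Sum.inr_injective)
        (fun _ _ => Iff.rfl) (fun _ _ => Iff.rfl) (fun _ _ => Iff.rfl) (fun _ _ => Iff.rfl) h₂ h₂'
      rw [hl f, hr g]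

theorem isAv_ofPerm {n : ℕ} {σ : Equiv.Perm (Fin n)} (h : Avoids σ) : IsAv (ofPerm σ) where
  P_irrefl _ := lt_irrefl _
  P_trans _ _ _ := lt_trans
  P_total _ _ h := lt_or_gt_of_ne (α := Fin n) h
  V_irrefl _ := lt_irrefl _
  V_trans _ _ _ := lt_trans
  V_total _ _ h := lt_or_gt_of_ne (σ.injective.ne h)
  avoids x y z h₁ h₂ h₃ h₄ := h ⟨x, y, z, h₁, h₂, h₃, h₄⟩
  not_hP _ := id
  not_hV _ := id

theorem eq_of_iso_ofPerm {n : ℕ} {σ τ : Equiv.Perm (Fin n)} (e : Iso (ofPerm σ) (ofPerm τ)) :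
    σ = τ := by
  have rigid (f : Fin n ≃ Fin n) (hf : ∀ x y, x < y ↔ f x < f y) : f = Equiv.refl _ := by
    have : (StrictMono.orderIsoOfSurjective f (fun x y => (hf x y).1) f.surjective) =
      OrderIso.refl _ := Subsingleton.elim _ _
    ext x
    exact congrArg Fin.val (DFunLike.congr_fun this x)
  have he : e.toEquiv = Equiv.refl (Fin n) := rigid e.toEquiv e.map_P
  have hV (x y : Fin n) : σ x < σ y ↔ τ x < τ y := by
    have := e.map_V x y
    change σ x < σ y ↔ τ (e.toEquiv x) < τ (e.toEquiv y) at this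
    rwa [he] at this
  have := rigid (σ.symm.trans τ) fun x y => by simpa using hV (σ.symm x) (σ.symm y)
  ext x
  simpa using congrArg Fin.val (Equiv.congr_fun this (σ x)).symm

theorem IsAv.exists_ofPerm [Finite A] (hA : IsAv A) {n : ℕ} (hn : Nat.card A = n) :
    ∃ σ : Equiv.Perm (Fin n), Avoids σ ∧ Nonempty (Iso (ofPerm σ) A) := by
  have sort (r : A → A → Prop) (h₁ : ∀ x, ¬ r x x) (h₂ : ∀ x y z, r x y → r y z → r x z)
      (h₃ : ∀ x y, x ≠ y → r x y ∨ r y x) : ∃ f : Fin n ≃ A, ∀ x y, x < y ↔ r (f x) (f y) := by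
    classical
    have : IsStrictTotalOrder A r :=
      { irrefl := h₁, trans := h₂, trichotomous := fun x y hxy hyx => by
          by_contra h
          exact (h₃ x y h).elim hxy hyx }
    let : LinearOrder A := linearOrderOfSTO r
    let : Fintype A := Fintype.ofFinite A
    let f := Fintype.orderIsoFinOfCardEq A (Nat.card_eq_fintype_card.symm.trans hn)
    exact ⟨f.toEquiv, fun x y => f.lt_iff_lt.symm⟩
  obtain ⟨f, hf⟩ := sort A.P hA.P_irrefl hA.P_trans hA.P_total
  obtain ⟨g, hg⟩ := sort A.V hA.V_irrefl hA.V_trans hA.V_total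
  have hV (x y : Fin n) : (f.trans g.symm) x < (f.trans g.symm) y ↔ A.V (f x) (f y) := by
    simp [hg]
  refine ⟨f.trans g.symm, ?_, ⟨⟨f, hf, hV, fun x => iff_of_false id (hA.not_hP _),
    fun x => iff_of_false id (hA.not_hV _)⟩⟩⟩
  rintro ⟨i, j, k, h₁, h₂, h₃, h₄⟩
  exact hA.avoids _ _ _ ((hf _ _).1 h₁) ((hf _ _).1 h₂) ((hV _ _).1 h₃) ((hV _ _).1 h₄)

end Marked

open BinaryTree in
/-- Counting 231-avoiding permutations amounts to counting trees. -/
theorem avN_eq_card_trees (n : ℕ) (ψ : L.Sentence) :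
    avN n ψ = Nat.card {t : BinaryTree Unit // t.numNodes = n ∧ (ofTree t).Models ψ} := by
  have key (x : {σ : Equiv.Perm (Fin n) // Avoids σ ∧ Sat σ ψ}) :
      ∃ t : {t : BinaryTree Unit // t.numNodes = n ∧ (ofTree t).Models ψ},
        Nonempty (Iso (ofTree t.1) (ofPerm x.1)) := by
    obtain ⟨σ, hσ, hψ⟩ := x
    have : Finite (ofPerm σ) := inferInstanceAs (Finite (Fin n))
    obtain ⟨t, ⟨e⟩⟩ := (isAv_ofPerm hσ).exists_ofTree
    refine ⟨⟨t, ?_, (EF.of_iso _ e).models_iff.2 ((sat_iff_models σ ψ).1 hψ)⟩, ⟨e⟩⟩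
    rw [← card_ofTree, Nat.card_congr e.toEquiv]
    exact Nat.card_fin n
  choose f hf using key
  refine Nat.card_eq_of_bijective f ⟨fun x y hxy => ?_, fun ⟨t, ht, hψ⟩ => ?_⟩
  · obtain ⟨e⟩ := hf x
    obtain ⟨e'⟩ := hf y
    rw [← hxy] at e'
    exact Subtype.ext (eq_of_iso_ofPerm (e.symm.trans e'))
  · obtain ⟨σ, hσ, ⟨e⟩⟩ := (isAv_ofTree t).exists_ofPerm ((card_ofTree t).trans ht)
    refine ⟨⟨σ, hσ, (sat_iff_models σ ψ).2 ((EF.of_iso _ e).models_iff.2 hψ)⟩, ?_⟩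
    obtain ⟨e'⟩ := hf ⟨σ, hσ, (sat_iff_models σ ψ).2 ((EF.of_iso _ e).models_iff.2 hψ)⟩
    exact Subtype.ext (eq_of_iso_ofTree (e'.trans e))

/-! ### Catalan numbers -/

theorem catalan_pos (n : ℕ) : (0 : ℝ) < catalan n := by
  have h := succ_mul_catalan_eq_centralBinom n
  have := Nat.centralBinom_pos n
  exact_mod_cast Nat.pos_of_ne_zero fun h0 => by simp [h0] at h; omega

theorem succ_mul_catalan (n : ℕ) : ((n : ℝ) + 1) * catalan n = n.centralBinom := by
  exact_mod_cast succ_mul_catalan_eq_centralBinom n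

theorem succ_mul_centralBinom_succ (n : ℕ) :
    ((n : ℝ) + 1) * (n + 1).centralBinom = 2 * (2 * n + 1) * n.centralBinom := by
  exact_mod_cast Nat.succ_mul_centralBinom_succ n

theorem add_two_mul_catalan_succ (n : ℕ) :
    ((n : ℝ) + 2) * catalan (n + 1) = (4 * n + 2) * catalan n := by
  have h₁ := succ_mul_catalan n
  have h₂ := succ_mul_catalan (n + 1)
  have h₃ := succ_mul_centralBinom_succ n
  push_cast at h₂
  have : ((n : ℝ) + 1) ≠ 0 := by positivity
  apply mul_left_cancel₀ this
  rw [← h₁, ← h₂] at h₃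
  linarith

theorem catalan_succ_le (n : ℕ) : (catalan (n + 1) : ℝ) ≤ 4 * catalan n := by
  have h := add_two_mul_catalan_succ n
  have := catalan_pos n
  have hn : (0 : ℝ) < (n : ℝ) + 2 := by positivity
  nlinarith

theorem catalan_add_le (n m : ℕ) : (catalan (n + m) : ℝ) ≤ 4 ^ m * catalan n := by
  induction m with
  | zero => simp
  | succ m ih => rw [← add_assoc, pow_succ']; linarith [catalan_succ_le (n + m)]

theorem tendsto_catalan_div_succ :
    Tendsto (fun n : ℕ => (catalan n : ℝ) / catalan (n + 1)) atTop (𝓝 (1 / 4)) := by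
  have h : (fun n : ℕ => (catalan n : ℝ) / catalan (n + 1)) =
      fun n : ℕ => 1 / 4 + 3 / 8 * (1 / ((n : ℝ) + 1 / 2)) := by
    ext n
    have := add_two_mul_catalan_succ n
    have := catalan_pos (n + 1)
    have hn : (0 : ℝ) < (n : ℝ) + 1 / 2 := by positivity
    field_simp
    linarith
  rw [h]
  have h₀ : Tendsto (fun n : ℕ => 1 / ((n : ℝ) + 1 / 2)) atTop (𝓝 0) :=
    tendsto_const_nhds.div_atTop
      (tendsto_atTop_add_const_right _ _ tendsto_natCast_atTop_atTop)
  simpa using tendsto_const_nhds.add (h₀.const_mul (3 / 8))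

theorem tendsto_catalan_div_add (m : ℕ) :
    Tendsto (fun n : ℕ => (catalan n : ℝ) / catalan (n + m)) atTop (𝓝 ((1 / 4) ^ m)) := by
  induction m with
  | zero => simp [div_self (catalan_pos _).ne']
  | succ m ih =>
    have := ih.mul ((tendsto_add_atTop_iff_nat m).2 tendsto_catalan_div_succ)
    rw [pow_succ]
    refine this.congr fun n => ?_
    rw [div_mul_div_cancel₀ (catalan_pos _).ne', add_assoc]

theorem tendsto_catalan_sub_div_succ (i : ℕ) :
    Tendsto (fun n : ℕ => (catalan (n - i) : ℝ) / catalan (n + 1)) atTop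
      (𝓝 ((1 / 4) ^ (i + 1))) := by
  rw [← tendsto_add_atTop_iff_nat i]
  refine (tendsto_catalan_div_add (i + 1)).congr fun n => ?_
  rw [Nat.add_sub_cancel, add_assoc]

theorem one_sub_two_mul_sum_catalan (K : ℕ) :
    1 - 2 * ∑ i ∈ Finset.range K, (catalan i : ℝ) * (1 / 4) ^ (i + 1) =
      K.centralBinom / 4 ^ K := by
  induction K with
  | zero => simp
  | succ K ih =>
    rw [Finset.sum_range_succ, mul_add, ← sub_sub, ih]
    have h₁ := succ_mul_catalan K
    have h₃ := succ_mul_centralBinom_succ K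
    have : ((K : ℝ) + 1) ≠ 0 := by positivity
    have key : 4 * (K.centralBinom : ℝ) - 2 * catalan K = (K + 1).centralBinom := by
      apply mul_left_cancel₀ this
      rw [h₃]
      linarith
    rw [← key, one_div, inv_pow, pow_succ]
    field_simp

theorem sq_centralBinom_le (K : ℕ) :
    (2 * K + 1) * ((K.centralBinom : ℝ) / 4 ^ K) ^ 2 ≤ 1 := by
  induction K with
  | zero => simp
  | succ K ih =>
    have h₃ := succ_mul_centralBinom_succ K
    have hK : (0 : ℝ) < (K : ℝ) + 1 := by positivity
    have key : ((K + 1).centralBinom : ℝ) / 4 ^ (K + 1) =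
        (2 * K + 1) / (2 * (K + 1)) * (K.centralBinom / 4 ^ K) := by
      rw [pow_succ]
      field_simp
      linarith
    rw [key, mul_pow]
    set x := ((K.centralBinom : ℝ) / 4 ^ K) ^ 2
    have hx : 0 ≤ x := by positivity
    refine le_trans ?_ ih
    rw [← mul_assoc]
    refine mul_le_mul_of_nonneg_right ?_ hx
    rw [div_pow, mul_div_assoc', div_le_iff₀ (by positivity)]
    push_cast
    nlinarith [(Nat.cast_nonneg K : (0 : ℝ) ≤ K)]

theorem tendsto_centralBinom_div :
    Tendsto (fun K : ℕ => (K.centralBinom : ℝ) / 4 ^ K) atTop (𝓝 0) := by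
  have h : Tendsto (fun K : ℕ => ((K.centralBinom : ℝ) / 4 ^ K) ^ 2) atTop (𝓝 0) := by
    refine squeeze_zero (fun K => by positivity) (fun K => ?_)
      tendsto_one_div_add_atTop_nhds_zero_nat
    rw [le_div_iff₀ (by positivity)]
    have := sq_centralBinom_le K
    nlinarith [sq_nonneg ((K.centralBinom : ℝ) / 4 ^ K), (Nat.cast_nonneg K : (0 : ℝ) ≤ K)]
  have := h.sqrt
  simp only [Real.sqrt_zero] at this
  exact this.congr fun K => Real.sqrt_sq (by positivity)

/-! ### Counting trees by type -/

open BinaryTree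

theorem sum_treesOfNumNodesEq_succ (n : ℕ) (f : BinaryTree Unit → ℝ) :
    ∑ t ∈ treesOfNumNodesEq (n + 1), f t = ∑ ij ∈ Finset.HasAntidiagonal.antidiagonal n,
      ∑ l ∈ treesOfNumNodesEq ij.1, ∑ r ∈ treesOfNumNodesEq ij.2, f (.node () l r) := by
  rw [treesOfNumNodesEq_succ, Finset.sum_biUnion]
  · refine Finset.sum_congr rfl fun ij _ => ?_
    rw [← Finset.sum_product' (treesOfNumNodesEq ij.1) (treesOfNumNodesEq ij.2)
      (fun l r => f (.node () l r)), pairwiseNode, Finset.sum_map]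
    rfl
  · intro ij _ ij' _ hne
    refine Finset.disjoint_left.2 fun t h h' => hne ?_
    simp only [pairwiseNode, Finset.mem_map, Finset.mem_product, mem_treesOfNumNodesEq] at h h'
    obtain ⟨⟨l, r⟩, ⟨h₁, h₂⟩, rfl⟩ := h
    obtain ⟨⟨l', r'⟩, ⟨h₁', h₂'⟩, he⟩ := h'
    obtain ⟨-, rfl, rfl⟩ := BinaryTree.node.inj he
    exact Prod.ext (h₁.symm.trans h₁') (h₂.symm.trans h₂')

section

variable {Q : Type} (ev : BinaryTree Unit → Q)

/-- The number of trees with `n` nodes whose type lies in `S`. -/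
noncomputable def treeCount (n : ℕ) (S : Set Q) : ℝ :=
  ∑ t ∈ treesOfNumNodesEq n, S.indicator (fun _ => (1 : ℝ)) (ev t)

/-- The proportion of trees with `n` nodes whose type lies in `S`. -/
noncomputable def treeProb (n : ℕ) (S : Set Q) : ℝ := treeCount ev n S / catalan n

theorem treeCount_nonneg (n : ℕ) (S : Set Q) : 0 ≤ treeCount ev n S :=
  Finset.sum_nonneg fun _ _ => Set.indicator_nonneg (fun _ _ => zero_le_one) _

theorem treeCount_univ (n : ℕ) : treeCount ev n Set.univ = catalan n := by
  simp [treeCount, treesOfNumNodesEq_card_eq_catalan]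

theorem treeCount_mono (n : ℕ) {S T : Set Q} (h : S ⊆ T) : treeCount ev n S ≤ treeCount ev n T :=
  Finset.sum_le_sum fun _ _ => Set.indicator_le_indicator_of_subset h (fun _ => zero_le_one) _

theorem treeCount_le (n : ℕ) (S : Set Q) : treeCount ev n S ≤ catalan n :=
  (treeCount_mono ev n (Set.subset_univ S)).trans (treeCount_univ ev n).le

theorem treeCount_add_compl (n : ℕ) (S : Set Q) :
    treeCount ev n S + treeCount ev n Sᶜ = catalan n := by
  rw [← treeCount_univ ev n, treeCount, treeCount, ← Finset.sum_add_distrib]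
  refine Finset.sum_congr rfl fun t _ => ?_
  by_cases h : ev t ∈ S <;> simp [h]

theorem treeProb_nonneg (n : ℕ) (S : Set Q) : 0 ≤ treeProb ev n S :=
  div_nonneg (treeCount_nonneg ev n S) (catalan_pos n).le

theorem treeProb_le_one (n : ℕ) (S : Set Q) : treeProb ev n S ≤ 1 :=
  div_le_one_of_le₀ (treeCount_le ev n S) (catalan_pos n).le

theorem treeProb_add_compl (n : ℕ) (S : Set Q) : treeProb ev n S + treeProb ev n Sᶜ = 1 := by
  rw [treeProb, treeProb, ← add_div, treeCount_add_compl, div_self (catalan_pos n).ne']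

theorem treeCount_eq (n : ℕ) (S : Set Q) : treeCount ev n S = treeProb ev n S * catalan n :=
  (div_mul_cancel₀ _ (catalan_pos n).ne').symm

variable {ev} {op : Q → Q → Q}

theorem sum_treeCount_left (n m : ℕ) (S : Set Q) : ∑ l ∈ treesOfNumNodesEq n,
    treeCount ev m {q | op (ev l) q ∈ S} = ∑ l ∈ treesOfNumNodesEq n, ∑ r ∈ treesOfNumNodesEq m,
      S.indicator (fun _ => (1 : ℝ)) (op (ev l) (ev r)) :=
  rfl

theorem sum_treeCount_right (n m : ℕ) (S : Set Q) : ∑ r ∈ treesOfNumNodesEq m,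
    treeCount ev n {q | op q (ev r) ∈ S} = ∑ l ∈ treesOfNumNodesEq n, ∑ r ∈ treesOfNumNodesEq m,
      S.indicator (fun _ => (1 : ℝ)) (op (ev l) (ev r)) := by
  rw [Finset.sum_comm]
  rfl

theorem treeCount_succ (hev : ∀ l r, ev (.node () l r) = op (ev l) (ev r)) (n : ℕ) (S : Set Q) :
    treeCount ev (n + 1) S = ∑ i ∈ Finset.range (n + 1), ∑ l ∈ treesOfNumNodesEq i,
      treeCount ev (n - i) {q | op (ev l) q ∈ S} := by
  rw [treeCount, sum_treesOfNumNodesEq_succ, Finset.Nat.sum_antidiagonal_eq_sum_range_succ_mk]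
  simp only [hev, sum_treeCount_left]

theorem sum_treeCount_left_le (n m : ℕ) (S : Set Q) : ∑ l ∈ treesOfNumNodesEq n,
    treeCount ev m {q | op (ev l) q ∈ S} ≤ catalan n * catalan m := by
  refine (Finset.sum_le_card_nsmul _ _ _ fun l _ => treeCount_le ev m _).trans ?_
  rw [treesOfNumNodesEq_card_eq_catalan, nsmul_eq_mul]

theorem sum_range_add_sum_range_sub_le {n K : ℕ} (hK : 2 * K ≤ n + 1) (H : ℕ → ℝ)
    (hH : ∀ i, 0 ≤ H i) : ∑ i ∈ Finset.range K, H i + ∑ i ∈ Finset.range K, H (n - i) ≤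
      ∑ i ∈ Finset.range (n + 1), H i := by
  have h : n + 1 = K + (n + 1 - 2 * K) + K := by omega
  rw [h, Finset.sum_range_add, Finset.sum_range_add, add_assoc]
  refine add_le_add le_rfl (le_add_of_nonneg_of_le (Finset.sum_nonneg fun _ _ => hH _) ?_)
  rw [← Finset.sum_range_reflect]
  refine (Finset.sum_congr rfl fun i hi => congrArg H ?_).le
  have := Finset.mem_range.1 hi
  omega

/-- The recursion for proportions, keeping only the terms in which one subtree has size less than
`K`. -/
theorem treeProb_succ_le (hev : ∀ l r, ev (.node () l r) = op (ev l) (ev r)) {n K : ℕ}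
    (hK : 2 * K ≤ n + 1) (S : Set Q) :
    treeProb ev (n + 1) S ≤ ∑ i ∈ Finset.range K, ∑ t ∈ treesOfNumNodesEq i,
      (catalan (n - i) / catalan (n + 1) : ℝ) * (treeProb ev (n - i) {q | op (ev t) q ∈ S} +
        treeProb ev (n - i) {q | op q (ev t) ∈ S}) +
      (1 - 2 * ∑ i ∈ Finset.range K, (catalan i : ℝ) * (catalan (n - i) / catalan (n + 1))) := by
  have hpos := catalan_pos (n + 1)
  let F (i : ℕ) : ℝ := ∑ l ∈ treesOfNumNodesEq i, treeCount ev (n - i) {q | op (ev l) q ∈ S}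
  have hcat : ∑ i ∈ Finset.range (n + 1), (catalan i * catalan (n - i) : ℝ) = catalan (n + 1) := by
    rw [catalan_succ', Finset.Nat.sum_antidiagonal_eq_sum_range_succ_mk]
    push_cast
    rfl
  have key := sum_range_add_sum_range_sub_le hK (fun i => catalan i * catalan (n - i) - F i)
    fun i => sub_nonneg.2 (sum_treeCount_left_le _ _ _)
  simp only [Finset.sum_sub_distrib] at key
  rw [hcat, ← treeCount_succ hev] at key
  have h₁ : ∑ i ∈ Finset.range K, (catalan (n - i) * catalan (n - (n - i)) : ℝ) =
      ∑ i ∈ Finset.range K, (catalan i * catalan (n - i) : ℝ) := by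
    refine Finset.sum_congr rfl fun i hi => ?_
    have := Finset.mem_range.1 hi
    rw [Nat.sub_sub_self (by omega), mul_comm]
  have h₂ : ∑ i ∈ Finset.range K, F (n - i) = ∑ i ∈ Finset.range K, ∑ t ∈ treesOfNumNodesEq i,
      treeCount ev (n - i) {q | op q (ev t) ∈ S} := by
    refine Finset.sum_congr rfl fun i hi => ?_
    have := Finset.mem_range.1 hi
    simp only [F]
    rw [sum_treeCount_right, ← sum_treeCount_left, Nat.sub_sub_self (by omega : i ≤ n)]
  rw [h₁, h₂] at key
  have h₃ : (∑ i ∈ Finset.range K, ∑ t ∈ treesOfNumNodesEq i,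
      (catalan (n - i) / catalan (n + 1) : ℝ) * (treeProb ev (n - i) {q | op (ev t) q ∈ S} +
        treeProb ev (n - i) {q | op q (ev t) ∈ S})) * catalan (n + 1) =
      ∑ i ∈ Finset.range K, F i + ∑ i ∈ Finset.range K, ∑ t ∈ treesOfNumNodesEq i,
      treeCount ev (n - i) {q | op q (ev t) ∈ S} := by
    simp only [F, ← Finset.sum_add_distrib, Finset.sum_mul]
    refine Finset.sum_congr rfl fun i _ => Finset.sum_congr rfl fun t _ => ?_
    rw [treeCount_eq, treeCount_eq]
    field_simp
  have h₄ : (∑ i ∈ Finset.range K, (catalan i : ℝ) * (catalan (n - i) / catalan (n + 1))) *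
      catalan (n + 1) = ∑ i ∈ Finset.range K, (catalan i * catalan (n - i) : ℝ) := by
    rw [Finset.sum_mul]
    refine Finset.sum_congr rfl fun i _ => ?_
    field_simp
  rw [treeProb, div_le_iff₀ hpos, add_mul, sub_mul, mul_assoc, h₃, h₄]
  linarith

end

/-! ### Convergence -/

section

variable {Q : Type} (ev : BinaryTree Unit → Q)

/-- The upper limit of the proportion of trees whose type lies in `S`. -/
noncomputable def upperProb (S : Set Q) : ℝ := limsup (fun n => treeProb ev n S) atTop

/-- The gap between the upper and the lower limit of the proportion of trees whose type lies in
`S`. -/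
noncomputable def oscProb (S : Set Q) : ℝ := upperProb ev S + upperProb ev Sᶜ - 1

variable {ev}

theorem upperProb_le {S : Set Q} {a : ℝ} (h : ∀ᶠ n in atTop, treeProb ev n S ≤ a) :
    upperProb ev S ≤ a :=
  limsup_le_of_le (IsBoundedUnder.isCoboundedUnder_le ⟨0, eventually_map.2 <|
    Eventually.of_forall fun n => treeProb_nonneg ev n S⟩) h

theorem eventually_treeProb_lt {S : Set Q} {a : ℝ} (h : upperProb ev S < a) :
    ∀ᶠ n in atTop, treeProb ev n S < a :=
  eventually_lt_of_limsup_lt h ⟨1, eventually_map.2 <|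
    Eventually.of_forall fun n => treeProb_le_one ev n S⟩

theorem tendsto_treeProb {S : Set Q} (h : oscProb ev S ≤ 0) :
    Tendsto (fun n => treeProb ev n S) atTop (𝓝 (upperProb ev S)) := by
  rw [oscProb] at h
  refine tendsto_order.2 ⟨fun a ha => ?_, fun a ha => eventually_treeProb_lt ha⟩
  filter_upwards [eventually_treeProb_lt (by linarith : upperProb ev Sᶜ < 1 - a)] with n hn
  linarith [treeProb_add_compl ev n S]

theorem oscProb_univ : oscProb ev Set.univ ≤ 0 := by
  have h₁ : upperProb ev Set.univ ≤ 1 :=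
    upperProb_le (Eventually.of_forall fun n => treeProb_le_one ev n _)
  have h₂ : upperProb ev Set.univᶜ ≤ 0 :=
    upperProb_le (Eventually.of_forall fun n => by simp [treeProb, treeCount])
  rw [oscProb]
  linarith

theorem oscProb_compl (S : Set Q) : oscProb ev Sᶜ = oscProb ev S := by
  rw [oscProb, oscProb, compl_compl, add_comm (upperProb ev S)]

variable {op : Q → Q → Q}

theorem upperProb_le_sum [Finite Q] (hev : ∀ l r, ev (.node () l r) = op (ev l) (ev r)) (K : ℕ)
    (S : Set Q) :
    upperProb ev S ≤ ∑ i ∈ Finset.range K, ∑ t ∈ treesOfNumNodesEq i, ((1 / 4) ^ (i + 1) : ℝ) *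
      (upperProb ev {q | op (ev t) q ∈ S} + upperProb ev {q | op q (ev t) ∈ S}) +
      K.centralBinom / 4 ^ K := by
  refine le_of_forall_pos_le_add fun δ hδ => upperProb_le ?_
  have hev_all : ∀ᶠ n in atTop, ∀ T : Set Q, treeProb ev n T < upperProb ev T + δ / 2 :=
    eventually_all.2 fun T => eventually_treeProb_lt (by linarith)
  have hshift : ∀ᶠ n in atTop, ∀ i < K, ∀ T : Set Q,
      treeProb ev (n - i) T < upperProb ev T + δ / 2 := by
    obtain ⟨n₀, hn₀⟩ := eventually_atTop.1 hev_all
    exact eventually_atTop.2 ⟨n₀ + K, fun n hn i hi => hn₀ _ (by omega)⟩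
  let G (n : ℕ) : ℝ := ∑ i ∈ Finset.range K, ∑ t ∈ treesOfNumNodesEq i,
      (catalan (n - i) / catalan (n + 1) : ℝ) * (upperProb ev {q | op (ev t) q ∈ S} + δ / 2 +
        (upperProb ev {q | op q (ev t) ∈ S} + δ / 2)) +
      (1 - 2 * ∑ i ∈ Finset.range K, (catalan i : ℝ) * (catalan (n - i) / catalan (n + 1)))
  have hle : ∀ᶠ n in atTop, treeProb ev (n + 1) S ≤ G n := by
    filter_upwards [hshift, eventually_ge_atTop (2 * K)] with n hn hnK
    refine (treeProb_succ_le hev (by omega) S).trans (add_le_add ?_ le_rfl)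
    refine Finset.sum_le_sum fun i hi => Finset.sum_le_sum fun t _ => ?_
    have hi := Finset.mem_range.1 hi
    exact mul_le_mul_of_nonneg_left (add_le_add (hn i hi _).le (hn i hi _).le)
      (div_nonneg (catalan_pos _).le (catalan_pos _).le)
  have hG : Tendsto G atTop (𝓝 (∑ i ∈ Finset.range K, ∑ t ∈ treesOfNumNodesEq i,
      ((1 / 4) ^ (i + 1) : ℝ) * (upperProb ev {q | op (ev t) q ∈ S} + δ / 2 +
        (upperProb ev {q | op q (ev t) ∈ S} + δ / 2)) +
      (1 - 2 * ∑ i ∈ Finset.range K, (catalan i : ℝ) * (1 / 4) ^ (i + 1)))) := by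
    refine Tendsto.add (tendsto_finsetSum _ fun i _ => tendsto_finsetSum _ fun t _ =>
      (tendsto_catalan_sub_div_succ i).mul_const _) (Tendsto.const_sub _ (Tendsto.const_mul _
        (tendsto_finsetSum _ fun i _ => (tendsto_catalan_sub_div_succ i).const_mul _)))
  have hsum : ∑ i ∈ Finset.range K, ∑ t ∈ treesOfNumNodesEq i,
      ((1 / 4) ^ (i + 1) : ℝ) * (upperProb ev {q | op (ev t) q ∈ S} + δ / 2 +
        (upperProb ev {q | op q (ev t) ∈ S} + δ / 2)) =
      ∑ i ∈ Finset.range K, ∑ t ∈ treesOfNumNodesEq i, ((1 / 4) ^ (i + 1) : ℝ) *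
      (upperProb ev {q | op (ev t) q ∈ S} + upperProb ev {q | op q (ev t) ∈ S}) +
      δ * ∑ i ∈ Finset.range K, (catalan i : ℝ) * (1 / 4) ^ (i + 1) := by
    rw [Finset.mul_sum, ← Finset.sum_add_distrib]
    refine Finset.sum_congr rfl fun i _ => ?_
    rw [← treesOfNumNodesEq_card_eq_catalan, ← nsmul_eq_mul, ← Finset.sum_const, Finset.mul_sum,
      ← Finset.sum_add_distrib]
    refine Finset.sum_congr rfl fun t _ => by ring
  have hr := one_sub_two_mul_sum_catalan K
  have hr₀ : (0 : ℝ) ≤ K.centralBinom / 4 ^ K := by positivity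
  rw [hsum, hr] at hG
  have hδle : δ * ∑ i ∈ Finset.range K, (catalan i : ℝ) * (1 / 4) ^ (i + 1) ≤ δ / 2 := by
    nlinarith
  obtain ⟨n₀, hn₀⟩ := eventually_atTop.1
    (hle.and (hG.eventually_lt_const (lt_add_of_pos_right _ (half_pos hδ))))
  refine eventually_atTop.2 ⟨n₀ + 1, fun n hn => ?_⟩
  obtain ⟨h₁, h₂⟩ := hn₀ (n - 1) (by omega)
  rw [Nat.sub_add_cancel (by omega)] at h₁
  linarith

theorem oscProb_le_sum [Finite Q] (hev : ∀ l r, ev (.node () l r) = op (ev l) (ev r)) (K : ℕ)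
    (S : Set Q) :
    oscProb ev S ≤ ∑ i ∈ Finset.range K, ∑ t ∈ treesOfNumNodesEq i, ((1 / 4) ^ (i + 1) : ℝ) *
      (oscProb ev {q | op (ev t) q ∈ S} + oscProb ev {q | op q (ev t) ∈ S}) +
      K.centralBinom / 4 ^ K := by
  have h₁ := upperProb_le_sum hev K S
  have h₂ := upperProb_le_sum hev K Sᶜ
  have hr := one_sub_two_mul_sum_catalan K
  have hsum : ∑ i ∈ Finset.range K, ∑ t ∈ treesOfNumNodesEq i, ((1 / 4) ^ (i + 1) : ℝ) *
      (oscProb ev {q | op (ev t) q ∈ S} + oscProb ev {q | op q (ev t) ∈ S}) =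
      ∑ i ∈ Finset.range K, ∑ t ∈ treesOfNumNodesEq i, ((1 / 4) ^ (i + 1) : ℝ) *
      (upperProb ev {q | op (ev t) q ∈ S} + upperProb ev {q | op q (ev t) ∈ S}) +
      ∑ i ∈ Finset.range K, ∑ t ∈ treesOfNumNodesEq i, ((1 / 4) ^ (i + 1) : ℝ) *
      (upperProb ev {q | op (ev t) q ∈ Sᶜ} + upperProb ev {q | op q (ev t) ∈ Sᶜ}) -
      2 * ∑ i ∈ Finset.range K, (catalan i : ℝ) * (1 / 4) ^ (i + 1) := by
    rw [Finset.mul_sum, ← Finset.sum_add_distrib, ← Finset.sum_sub_distrib]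
    refine Finset.sum_congr rfl fun i _ => ?_
    rw [← treesOfNumNodesEq_card_eq_catalan, ← nsmul_eq_mul, ← Finset.sum_const, Finset.mul_sum,
      ← Finset.sum_add_distrib, ← Finset.sum_sub_distrib]
    refine Finset.sum_congr rfl fun t _ => ?_
    have e₁ : {q | op (ev t) q ∈ S}ᶜ = {q | op (ev t) q ∈ Sᶜ} := rfl
    have e₂ : {q | op q (ev t) ∈ S}ᶜ = {q | op q (ev t) ∈ Sᶜ} := rfl
    rw [oscProb, oscProb, e₁, e₂]
    ring
  rw [hsum, oscProb]
  linarith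

theorem oscProb_preimage_eq [Finite Q] (hev : ∀ l r, ev (.node () l r) = op (ev l) (ev r))
    {S : Set Q} (hS : ∀ T, oscProb ev T ≤ oscProb ev S) (t : BinaryTree Unit) :
    oscProb ev {q | op (ev t) q ∈ S} = oscProb ev S ∧
      oscProb ev {q | op q (ev t) ∈ S} = oscProb ev S := by
  let E (t : BinaryTree Unit) : ℝ := 2 * oscProb ev S - (oscProb ev {q | op (ev t) q ∈ S} +
    oscProb ev {q | op q (ev t) ∈ S})
  have hE (t) : 0 ≤ E t := by
    have h₁ := hS {q | op (ev t) q ∈ S}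
    have h₂ := hS {q | op q (ev t) ∈ S}
    simp only [E]
    linarith
  have hle (K : ℕ) (hK : t.numNodes < K) : (1 / 4) ^ (t.numNodes + 1) * E t ≤
      (K.centralBinom / 4 ^ K : ℝ) * (1 - oscProb ev S) := by
    have hr := one_sub_two_mul_sum_catalan K
    have hsum : ∑ i ∈ Finset.range K, ∑ t ∈ treesOfNumNodesEq i, ((1 / 4) ^ (i + 1) : ℝ) * E t =
        2 * oscProb ev S * ∑ i ∈ Finset.range K, (catalan i : ℝ) * (1 / 4) ^ (i + 1) -
        ∑ i ∈ Finset.range K, ∑ t ∈ treesOfNumNodesEq i, ((1 / 4) ^ (i + 1) : ℝ) *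
      (oscProb ev {q | op (ev t) q ∈ S} + oscProb ev {q | op q (ev t) ∈ S}) := by
      rw [Finset.mul_sum, ← Finset.sum_sub_distrib]
      refine Finset.sum_congr rfl fun i _ => ?_
      rw [← treesOfNumNodesEq_card_eq_catalan, ← nsmul_eq_mul, ← Finset.sum_const, Finset.mul_sum,
        ← Finset.sum_sub_distrib]
      exact Finset.sum_congr rfl fun t _ => by simp only [E]; ring
    have hsingle : (1 / 4) ^ (t.numNodes + 1) * E t ≤
        ∑ i ∈ Finset.range K, ∑ t ∈ treesOfNumNodesEq i, ((1 / 4) ^ (i + 1) : ℝ) * E t := by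
      refine le_trans ?_ (Finset.single_le_sum (f := fun i => ∑ t ∈ treesOfNumNodesEq i,
        ((1 / 4) ^ (i + 1) : ℝ) * E t) (fun i _ => Finset.sum_nonneg fun t _ =>
          mul_nonneg (by positivity) (hE t)) (Finset.mem_range.2 hK))
      exact Finset.single_le_sum (f := fun s => ((1 / 4) ^ (t.numNodes + 1) : ℝ) * E s)
        (fun s _ => mul_nonneg (by positivity) (hE s)) (mem_treesOfNumNodesEq_numNodes t)
    have := oscProb_le_sum hev K S
    have h : 2 * oscProb ev S * ∑ i ∈ Finset.range K, (catalan i : ℝ) * (1 / 4) ^ (i + 1) =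
        oscProb ev S - oscProb ev S * (K.centralBinom / 4 ^ K) := by
      rw [← hr]
      ring
    rw [hsum, h] at hsingle
    linarith
  have hlim : (1 / 4) ^ (t.numNodes + 1) * E t ≤ 0 := by
    refine ge_of_tendsto (x := atTop) (f := fun K : ℕ =>
      (K.centralBinom / 4 ^ K : ℝ) * (1 - oscProb ev S)) ?_ ?_
    · simpa using tendsto_centralBinom_div.mul_const (1 - oscProb ev S)
    · filter_upwards [eventually_gt_atTop t.numNodes] with K hK using hle K hK
  have hE₀ : E t ≤ 0 := nonpos_of_mul_nonpos_right hlim (by positivity)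
  have h₁ := hS {q | op (ev t) q ∈ S}
  have h₂ := hS {q | op q (ev t) ∈ S}
  simp only [E] at hE₀
  constructor <;> linarith

theorem oscProb_nonpos [Finite Q] (hev : ∀ l r, ev (.node () l r) = op (ev l) (ev r))
    (hsurj : Function.Surjective ev) {f : Q → Q} {q₀ : Q} (hf : IsContext op f)
    (hconst : ∀ x, f x = q₀) (S : Set Q) : oscProb ev S ≤ 0 := by
  obtain ⟨M, hM⟩ := Finite.exists_max (oscProb ev)
  refine (hM S).trans ?_
  have key {g : Q → Q} (hg : IsContext op g) : oscProb ev (g ⁻¹' M) = oscProb ev M := by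
    induction hg with
    | id => rfl
    | left q g hg ih =>
      obtain ⟨t, rfl⟩ := hsurj q
      rw [← ih] at hM
      exact ((oscProb_preimage_eq hev hM t).1).trans ih
    | right q g hg ih =>
      obtain ⟨t, rfl⟩ := hsurj q
      rw [← ih] at hM
      exact ((oscProb_preimage_eq hev hM t).2).trans ih
  rw [← key hf]
  by_cases h : q₀ ∈ M
  · have hM : f ⁻¹' M = Set.univ := by ext x; simp [hconst, h]
    rw [hM]
    exact oscProb_univ
  · have hM : f ⁻¹' M = Set.univᶜ := by ext x; simp [hconst, h]
    rw [hM, oscProb_compl]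
    exact oscProb_univ

end

/-! ### The dichotomy -/

section

variable {Q : Type} {ev : BinaryTree Unit → Q} {op : Q → Q → Q}

theorem treeCount_le_treeCount_left (hev : ∀ l r, ev (.node () l r) = op (ev l) (ev r))
    (t : BinaryTree Unit) (n : ℕ) (S : Set Q) :
    treeCount ev n {q | op (ev t) q ∈ S} ≤ treeCount ev (n + (t.numNodes + 1)) S := by
  rw [← add_assoc, treeCount_succ hev]
  refine le_trans ?_ (Finset.single_le_sum (fun i _ => Finset.sum_nonneg fun l _ =>
    treeCount_nonneg ev _ _) (Finset.mem_range.2 (by omega : t.numNodes < n + t.numNodes + 1)))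
  rw [Nat.add_sub_cancel]
  exact Finset.single_le_sum (f := fun l => treeCount ev n {q | op (ev l) q ∈ S})
    (fun l _ => treeCount_nonneg ev _ _) (mem_treesOfNumNodesEq_numNodes t)

theorem treeCount_le_treeCount_right (hev : ∀ l r, ev (.node () l r) = op (ev l) (ev r))
    (t : BinaryTree Unit) (n : ℕ) (S : Set Q) :
    treeCount ev n {q | op q (ev t) ∈ S} ≤ treeCount ev (n + (t.numNodes + 1)) S := by
  rw [← add_assoc, treeCount_succ hev]
  refine le_trans ?_ (Finset.single_le_sum (fun i _ => Finset.sum_nonneg fun l _ =>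
    treeCount_nonneg ev _ _) (Finset.mem_range.2 (by omega : n < n + t.numNodes + 1)))
  rw [Nat.add_sub_cancel_left, sum_treeCount_left, ← sum_treeCount_right]
  exact Finset.single_le_sum (f := fun r => treeCount ev n {q | op q (ev r) ∈ S})
    (fun l _ => treeCount_nonneg ev _ _) (mem_treesOfNumNodesEq_numNodes t)

theorem IsContext.exists_treeCount_le (hev : ∀ l r, ev (.node () l r) = op (ev l) (ev r))
    (hsurj : Function.Surjective ev) {f : Q → Q} (hf : IsContext op f) :
    ∃ m, ∀ n S, treeCount ev n (f ⁻¹' S) ≤ treeCount ev (n + m) S := by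
  induction hf with
  | id => exact ⟨0, fun n S => le_rfl⟩
  | left q g hg ih =>
    obtain ⟨t, rfl⟩ := hsurj q
    obtain ⟨m, hm⟩ := ih
    refine ⟨t.numNodes + 1 + m, fun n S => ?_⟩
    rw [← add_assoc]
    exact (treeCount_le_treeCount_left hev t n (g ⁻¹' S)).trans (hm _ S)
  | right q g hg ih =>
    obtain ⟨t, rfl⟩ := hsurj q
    obtain ⟨m, hm⟩ := ih
    refine ⟨t.numNodes + 1 + m, fun n S => ?_⟩
    rw [← add_assoc]
    exact (treeCount_le_treeCount_right hev t n (g ⁻¹' S)).trans (hm _ S)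

theorem upperProb_pos (hev : ∀ l r, ev (.node () l r) = op (ev l) (ev r))
    (hsurj : Function.Surjective ev) {f : Q → Q} {q₀ : Q} (hf : IsContext op f)
    (hconst : ∀ x, f x = q₀) {S : Set Q} (hq₀ : q₀ ∈ S) : 0 < upperProb ev S := by
  obtain ⟨m, hm⟩ := hf.exists_treeCount_le hev hsurj
  by_contra! h
  have hlt : upperProb ev S < (1 / 4) ^ m := h.trans_lt (by positivity)
  obtain ⟨n₀, hn₀⟩ := eventually_atTop.1 (eventually_treeProb_lt hlt)
  refine (hn₀ (n₀ + m) (by omega)).not_ge ?_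
  have hcount := hm n₀ S
  rw [show f ⁻¹' S = Set.univ by ext x; simp [hconst, hq₀], treeCount_univ] at hcount
  rw [treeProb, le_div_iff₀ (catalan_pos _)]
  refine le_trans ?_ hcount
  have := catalan_add_le n₀ m
  rw [one_div, inv_pow, inv_mul_le_iff₀ (by positivity)]
  exact this

theorem sum_range_sum_mul_le_sq {x : ℕ → ℝ} (hx : ∀ n, 0 ≤ x n) (N : ℕ) :
    ∑ n ∈ Finset.range N, ∑ i ∈ Finset.range (n + 1), x i * x (n - i) ≤
      (∑ n ∈ Finset.range N, x n) ^ 2 := by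
  rw [Finset.sum_range_diag_flip N fun i j => x i * x j, sq, Finset.sum_mul_sum]
  refine Finset.sum_le_sum fun i _ => Finset.sum_le_sum_of_subset_of_nonneg
    (Finset.range_mono (Nat.sub_le N i)) fun j _ _ => mul_nonneg (hx i) (hx j)

/-- A sequence satisfying the Catalan recursion as an inequality, strict at one place, grows
at a strictly smaller exponential rate than the Catalan numbers. -/
theorem exists_mul_pow_le_two {b : ℕ → ℝ} (hb : ∀ n, 0 ≤ b n) (hcat : ∀ n, b n ≤ catalan n)
    (m : ℕ) (hrec : ∀ n, b (n + 1) + (if n = m then 1 else 0) ≤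
      ∑ i ∈ Finset.range (n + 1), b i * b (n - i)) :
    ∃ z : ℝ, 1 / 4 < z ∧ ∀ n, b n * z ^ n ≤ 2 := by
  obtain ⟨z, hz, hz₁, hz₂⟩ : ∃ z : ℝ, 1 / 4 < z ∧ 4 * z - z ^ (m + 1) < 1 ∧
      ∑ n ∈ Finset.range (m + 1), (catalan n : ℝ) * z ^ n < 2 := by
    have h₁ : ∀ᶠ z : ℝ in 𝓝 (1 / 4), 4 * z - z ^ (m + 1) < 1 := by
      refine ContinuousAt.eventually_lt (by fun_prop) continuousAt_const ?_
      norm_num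
    have h₂ : ∀ᶠ z : ℝ in 𝓝 (1 / 4),
        ∑ n ∈ Finset.range (m + 1), (catalan n : ℝ) * z ^ n < 2 := by
      refine ContinuousAt.eventually_lt (by fun_prop) continuousAt_const ?_
      have h := one_sub_two_mul_sum_catalan (m + 1)
      have hpos : (0 : ℝ) < (m + 1).centralBinom / 4 ^ (m + 1) :=
        div_pos (by exact_mod_cast Nat.centralBinom_pos _) (by positivity)
      simp only [pow_succ _ _, ← mul_assoc] at h
      rw [← Finset.sum_mul] at h
      simp only [pow_succ _ _] at hpos
      linarith
    obtain ⟨z, ⟨h₁, h₂⟩, hz⟩ := (((h₁.and h₂).filter_mono nhdsWithin_le_nhds).and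
      (self_mem_nhdsWithin (s := Set.Ioi (1 / 4 : ℝ)))).exists
    exact ⟨z, hz, h₁, h₂⟩
  have hz₀ : 0 < z := by linarith
  let x (n : ℕ) : ℝ := b n * z ^ n
  have hx (n) : 0 ≤ x n := mul_nonneg (hb n) (by positivity)
  have hsmall (N : ℕ) (hN : N ≤ m + 1) : ∑ n ∈ Finset.range N, x n ≤ 2 := by
    refine le_trans ?_ hz₂.le
    refine (Finset.sum_le_sum_of_subset_of_nonneg (Finset.range_mono hN) fun n _ _ => hx n).trans ?_
    exact Finset.sum_le_sum fun n _ => mul_le_mul_of_nonneg_right (hcat n) (by positivity)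
  have hstep (n : ℕ) : x (n + 1) ≤ z * ∑ i ∈ Finset.range (n + 1), x i * x (n - i) -
      if n = m then z ^ (m + 1) else 0 := by
    have h : z * ∑ i ∈ Finset.range (n + 1), x i * x (n - i) =
        z ^ (n + 1) * ∑ i ∈ Finset.range (n + 1), b i * b (n - i) := by
      rw [Finset.mul_sum, Finset.mul_sum]
      refine Finset.sum_congr rfl fun i hi => ?_
      have hi : i + (n - i) = n := by have := Finset.mem_range.1 hi; omega
      have hpow : z ^ (n + 1) = z ^ i * z ^ (n - i) * z := by rw [← pow_add, hi, pow_succ]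
      rw [hpow]
      ring
    rw [h]
    have hmul := mul_le_mul_of_nonneg_left (hrec n) (by positivity : 0 ≤ z ^ (n + 1))
    simp only [x]
    split_ifs with hn
    · subst hn
      simp only [if_true] at hmul
      linarith
    · rw [if_neg hn] at hmul
      linarith
  have hsum (N : ℕ) : ∑ n ∈ Finset.range N, x n ≤ 2 := by
    induction N with
    | zero => simp
    | succ N ih =>
      by_cases hN : N + 1 ≤ m + 1
      · exact hsmall _ hN
      have h₀ : x 0 ≤ 1 := by simpa [x] using hcat 0
      have h₁ := Finset.sum_le_sum fun n (_ : n ∈ Finset.range N) => hstep n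
      rw [Finset.sum_sub_distrib, Finset.sum_ite_eq', if_pos (Finset.mem_range.2 (by omega)),
        ← Finset.mul_sum] at h₁
      have h₂ := mul_le_mul_of_nonneg_left (sum_range_sum_mul_le_sq hx N) hz₀.le
      have h₃ : z * (∑ n ∈ Finset.range N, x n) ^ 2 ≤ z * 2 ^ 2 :=
        mul_le_mul_of_nonneg_left (pow_le_pow_left₀ (Finset.sum_nonneg fun n _ => hx n) ih 2) hz₀.le
      rw [Finset.sum_range_succ']
      linarith
  refine ⟨z, hz, fun n => le_trans ?_ (hsum (n + 1))⟩
  exact Finset.single_le_sum (f := x) (fun i _ => hx i) (Finset.self_mem_range_succ n)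

/-- The number of trees whose type avoids a nonempty ideal is exponentially small compared to
the Catalan numbers. -/
theorem exists_treeCount_compl_mul_pow_le (hev : ∀ l r, ev (.node () l r) = op (ev l) (ev r))
    (hsurj : Function.Surjective ev) {W : Set Q} (hne : W.Nonempty)
    (hleft : ∀ q, ∀ r ∈ W, op q r ∈ W) (hright : ∀ q, ∀ r ∈ W, op r q ∈ W) :
    ∃ z : ℝ, 1 / 4 < z ∧ ∀ n, treeCount ev n Wᶜ * z ^ n ≤ 2 := by
  by_cases hnil : ev .nil ∈ W
  · have hall (t) : ev t ∈ W := by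
      induction t with
      | nil => exact hnil
      | node _ l r _ ihr => exact hev l r ▸ hleft _ _ ihr
    exact ⟨1, by norm_num, fun n => by simp [treeCount, hall]⟩
  obtain ⟨l₀, r₀, hl₀, hr₀, hlr⟩ :
      ∃ l r, ev l ∉ W ∧ ev r ∉ W ∧ ev (.node () l r) ∈ W := by
    by_contra! h
    obtain ⟨q, hq⟩ := hne
    obtain ⟨t, rfl⟩ := hsurj q
    have hall (t) : ev t ∉ W := by
      induction t with
      | nil => exact hnil
      | node _ l r ihl ihr => exact h l r ihl ihr
    exact hall t hq
  let I : Q → ℝ := Wᶜ.indicator fun _ => 1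
  let d (l r : BinaryTree Unit) : ℝ := I (ev l) * I (ev r) - I (op (ev l) (ev r))
  have hd (l r) : 0 ≤ d l r := by
    by_cases hl : ev l ∈ W
    · simp [d, I, hl, hright _ _ hl]
    by_cases hr : ev r ∈ W
    · simp [d, I, hr, hleft _ _ hr]
    by_cases h : op (ev l) (ev r) ∈ W <;> simp [d, I, hl, hr, h]
  have hd₀ : d l₀ r₀ = 1 := by
    rw [hev] at hlr
    simp [d, I, hl₀, hr₀, hlr]
  refine exists_mul_pow_le_two (fun n => treeCount_nonneg ev n _) (fun n => treeCount_le ev n _)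
    (l₀.numNodes + r₀.numNodes) fun n => ?_
  have hsum : ∑ i ∈ Finset.range (n + 1), ∑ l ∈ treesOfNumNodesEq i,
      ∑ r ∈ treesOfNumNodesEq (n - i), d l r =
      ∑ i ∈ Finset.range (n + 1), treeCount ev i Wᶜ * treeCount ev (n - i) Wᶜ -
        treeCount ev (n + 1) Wᶜ := by
    rw [treeCount_succ hev, ← Finset.sum_sub_distrib]
    refine Finset.sum_congr rfl fun i _ => ?_
    rw [sum_treeCount_left, treeCount, treeCount, Finset.sum_mul_sum]
    simp only [d, I, Finset.sum_sub_distrib]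
  have hpos : (if n = l₀.numNodes + r₀.numNodes then 1 else 0 : ℝ) ≤
      ∑ i ∈ Finset.range (n + 1), ∑ l ∈ treesOfNumNodesEq i,
        ∑ r ∈ treesOfNumNodesEq (n - i), d l r := by
    split_ifs with hn
    · rw [← hd₀]
      refine le_trans ?_ (Finset.single_le_sum (fun i _ => Finset.sum_nonneg fun l _ =>
        Finset.sum_nonneg fun r _ => hd l r) (Finset.mem_range.2 (by omega : l₀.numNodes < n + 1)))
      refine le_trans ?_ (Finset.single_le_sum (fun l _ =>
        Finset.sum_nonneg fun r _ => hd l r) (mem_treesOfNumNodesEq_numNodes l₀))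
      exact Finset.single_le_sum (f := fun r => d l₀ r) (fun r _ => hd l₀ r)
        (mem_treesOfNumNodesEq.2 (by omega))
    · exact Finset.sum_nonneg fun i _ => Finset.sum_nonneg fun l _ =>
        Finset.sum_nonneg fun r _ => hd l r
  linarith

theorem four_pow_le_mul_catalan {n : ℕ} (hn : 0 < n) : (4 : ℝ) ^ n ≤ 4 * n ^ 2 * catalan n := by
  have h₁ : (4 : ℝ) ^ n ≤ 2 * n * n.centralBinom := by
    exact_mod_cast Nat.four_pow_le_two_mul_self_mul_centralBinom n hn
  rw [← succ_mul_catalan] at h₁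
  have hn' : (1 : ℝ) ≤ n := by exact_mod_cast hn
  have hα := catalan_pos n
  have : (2 * n : ℝ) * ((n + 1) * catalan n) ≤ 4 * n ^ 2 * catalan n := by
    have h : (0 : ℝ) ≤ n * catalan n * (n - 1) := by
      have : (0 : ℝ) ≤ n - 1 := by linarith
      positivity
    linarith
  linarith

theorem isBigO_treeProb {S : Set Q} {z : ℝ} (hz : 1 / 4 < z)
    (h : ∀ n, treeCount ev n S * z ^ n ≤ 2) :
    ∃ ε : ℝ, 0 ≤ ε ∧ ε < 1 ∧ (fun n => treeProb ev n S) =O[atTop] fun n : ℕ => ε ^ n := by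
  have hz₀ : 0 < z := by linarith
  let x : ℝ := 1 / (4 * z)
  have hx₀ : 0 < x := by positivity
  have hx₁ : x < 1 := by rw [div_lt_one (by positivity)]; linarith
  have hle : ∀ᶠ n : ℕ in atTop, ‖treeProb ev n S‖ ≤ 8 * ‖(n : ℝ) ^ 2 * x ^ n‖ := by
    filter_upwards [eventually_gt_atTop 0] with n hn
    rw [Real.norm_of_nonneg (treeProb_nonneg ev n S), Real.norm_of_nonneg (by positivity), treeProb,
      div_le_iff₀ (catalan_pos n)]
    have h₁ : treeCount ev n S ≤ 2 / z ^ n := (le_div_iff₀ (by positivity)).2 (h n)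
    have h₂ := four_pow_le_mul_catalan hn
    have hxn : x ^ n * 4 ^ n = 1 / z ^ n := by
      rw [← mul_pow, ← one_div_pow]
      congr 1
      simp only [x]
      field_simp
    have h₃ := mul_le_mul_of_nonneg_left h₂ (by positivity : 0 ≤ x ^ n)
    rw [hxn] at h₃
    rw [← mul_one_div] at h₁
    linarith
  refine ⟨(1 + x) / 2, by positivity, by linarith, (IsBigO.of_bound 8 hle).trans ?_⟩
  have hr : 1 < (1 + x) / 2 / x := by rw [lt_div_iff₀ hx₀]; linarith
  have hpow := (isLittleO_pow_const_const_pow_of_one_lt (R := ℝ) 2 hr).isBigO.mul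
    (isBigO_refl (fun n : ℕ => x ^ n) atTop)
  refine hpow.congr_right fun n => ?_
  rw [← mul_pow, div_mul_cancel₀ _ hx₀.ne']

theorem treeProb_dichotomy [Finite Q] (hev : ∀ l r, ev (.node () l r) = op (ev l) (ev r))
    (hsurj : Function.Surjective ev) (hap : ∀ f, IsContext op f → ∃ n, f^[n] = f^[n + 1])
    (S : Set Q) :
    (∃ l : ℝ, 0 < l ∧ Tendsto (fun n => treeProb ev n S) atTop (𝓝 l)) ∨
    (∃ ε : ℝ, 0 ≤ ε ∧ ε < 1 ∧ (fun n => treeProb ev n S) =O[atTop] fun n : ℕ => ε ^ n) := by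
  have : Nonempty Q := ⟨ev .nil⟩
  let W : Set Q := {q | ∃ f, IsContext op f ∧ ∀ x, f x = q}
  obtain ⟨f, q₀, hf, hconst⟩ := exists_constant_context op hap
  by_cases hSW : ∃ q ∈ S, q ∈ W
  · obtain ⟨q, hqS, g, hg, hgq⟩ := hSW
    exact .inl ⟨_, upperProb_pos hev hsurj hg hgq hqS,
      tendsto_treeProb (oscProb_nonpos hev hsurj hg hgq S)⟩
  · right
    have hleft : ∀ q, ∀ r ∈ W, op q r ∈ W := by
      rintro q r ⟨g, hg, hgr⟩
      exact ⟨_, (IsContext.left q _ .id).comp hg, fun x => by simp [hgr]⟩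
    have hright : ∀ q, ∀ r ∈ W, op r q ∈ W := by
      rintro q r ⟨g, hg, hgr⟩
      exact ⟨_, (IsContext.right q _ .id).comp hg, fun x => by simp [hgr]⟩
    obtain ⟨z, hz, hle⟩ := exists_treeCount_compl_mul_pow_le hev hsurj
      (⟨q₀, f, hf, hconst⟩ : W.Nonempty) hleft hright
    refine isBigO_treeProb hz fun n => le_trans ?_ (hle n)
    have hsub : S ⊆ Wᶜ := fun q hq hqW => hSW ⟨q, hq, hqW⟩
    exact mul_le_mul_of_nonneg_right (treeCount_mono ev n hsub) (by positivity)

end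

open Classical in
theorem prob_eq_treeProb (n : ℕ) (ψ : L.Sentence) {Q : Type} (ev : BinaryTree Unit → Q) (S : Set Q)
    (hS : ∀ t, ev t ∈ S ↔ (ofTree t).Models ψ) : prob n ψ = treeProb ev n S := by
  rw [prob, treeProb]
  congr 1
  have hcount : treeCount ev n S =
      ((treesOfNumNodesEq n).filter fun t => (ofTree t).Models ψ).card := by
    rw [treeCount, Finset.card_filter]
    push_cast
    refine Finset.sum_congr rfl fun t _ => ?_
    simp [Set.indicator_apply, hS]
  rw [hcount, avN_eq_card_trees, ← Nat.card_eq_finsetCard]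
  exact congrArg Nat.cast (Nat.card_congr (Equiv.subtypeEquivRight fun t => by
    rw [Finset.mem_filter, mem_treesOfNumNodesEq]))

/-- For a first-order sentence `ψ`, the probability that a uniform random 231-avoiding
permutation of size `n` satisfies `ψ` either converges to a positive limit, or
decays exponentially fast. -/
theorem positive_limit_or_exponential_decay (ψ : L.Sentence) :
    (∃ l : ℝ, 0 < l ∧ Tendsto (fun n : ℕ => prob n ψ) atTop (𝓝 l)) ∨
    (∃ ε : ℝ, 0 ≤ ε ∧ ε < 1 ∧ (fun n : ℕ => prob n ψ) =O[atTop] fun n : ℕ => ε ^ n) := by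
  let S : Set (TreeType (qd ψ)) :=
    {q | Quot.lift (fun t => (ofTree t).Models ψ) (fun _ _ h => propext h.models_iff) q}
  have hprob (n : ℕ) : prob n ψ = treeProb (treeType (qd ψ)) n S :=
    prob_eq_treeProb n ψ _ S fun t => Iff.rfl
  simp only [hprob]
  exact treeProb_dichotomy (treeType_node (qd ψ)) (treeType_surjective (qd ψ))
    (fun f hf => ⟨_, TreeType.iterate_eq_iterate_succ hf⟩) S

end Av231
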